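/- Assume the blow-up setup with p = n/(n−2), and assume in addition: d_k → 0; there is C₀ > 0 such that v_k(y) ≤ C₀ λ_k^{n/(p+1)} (1+λ_k|y−x_k|)^{2−n} for all y ∈ Ω and all k; H(x,y) ≤ C₀ dist(y,∂Ω)^{2−n} for all x ≠ y in Ω; and there is a continuous function U : ℝⁿ → (0,∞) such that λ_k^{−n/(q_k+1)} u_k(λ_k^{−1}x + x_k) → U(x) uniformly for x in the closed unit ball B̄(0,1). Then there exist constants c₂ > c₁ > 0 and C > 0, and positive reals K_k with c₁ log N_k ≤ K_k ≤ c₂ log N_k for all sufficiently large k, such that for all sufficiently large k and all x with |x−x_k| = 2d_k: |u_k(x) − K_k λ_k^{−n/(p+1)} G(x,x_k)| ≤ C λ_k^{−n/(p+1)} d_k^{−(n−2)} and |∇_x u_k(x) − K_k λ_k^{−n/(p+1)} ∇_x G(x,x_k)| ≤ C λ_k^{−n/(p+1)} d_k^{−(n−1)}. -/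

import Mathlib

open MeasureTheory Metric Filter Topology RealInnerProductSpace

noncomputable section

abbrev Euc (n : ℕ) := EuclideanSpace ℝ (Fin n)

noncomputable def surf (n : ℕ) : Measure (Euc n) := μH[(n : ℝ) - 1]

noncomputable def omegaSph (n : ℕ) : ℝ := (surf n (sphere (0 : Euc n) 1)).toReal

/-- `c_n = 1/((n-2) ω_{n-1})`. -/
noncomputable def cGreen (n : ℕ) : ℝ := 1 / (((n : ℝ) - 2) * omegaSph n)

/-- Laplacian on `ℝⁿ`. -/
noncomputable def lap (n : ℕ) (u : Euc n → ℝ) (x : Euc n) : ℝ :=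
  ∑ i : Fin n, fderiv ℝ (fun y => fderiv ℝ u y (EuclideanSpace.single i 1)) x
    (EuclideanSpace.single i 1)

/-- The blow-up setup: a bounded open set `Ω ⊆ ℝⁿ` with a Green-type kernel `G`
(with regular part `H`), exponents `p, q` on the critical hyperbola, perturbed exponents
`q_k` with `ε_k → 0`, positive solutions `(u_k, v_k)` of the integral form of the Lane–Emden
system, maximum values `λ_k` attained at `x_k`, with `λ_k → ∞`, `N_k = λ_k d_k → ∞` and
`λ_k^{ε_k}` bounded. -/
structure BlowupSetup (n : ℕ) where
  Ω : Set (Euc n)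
  hΩo : IsOpen Ω
  hΩb : Bornology.IsBounded Ω
  G : Euc n → Euc n → ℝ
  H : Euc n → Euc n → ℝ
  Gsymm : ∀ x y, G x y = G y x
  Gdecomp : ∀ x ∈ Ω, ∀ y ∈ Ω, x ≠ y →
    G x y = cGreen n * ‖x - y‖ ^ ((2 : ℝ) - n) - H x y
  Hharm : ∀ y ∈ Ω, ContDiffOn ℝ 2 (fun x => H x y) Ω ∧
    ∀ x ∈ Ω, lap n (fun z => H z y) x = 0
  Gpos : ∀ x ∈ Ω, ∀ y ∈ Ω, x ≠ y → 0 < G x y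
  Gle : ∀ x ∈ Ω, ∀ y ∈ Ω, x ≠ y → G x y ≤ cGreen n * ‖x - y‖ ^ ((2 : ℝ) - n)
  p : ℝ
  hp : 1 ≤ p
  q : ℝ
  hq : 0 < q
  hpq : 1 / (p + 1) + 1 / (q + 1) = ((n : ℝ) - 2) / n
  eps : ℕ → ℝ
  heps : ∀ k, 0 < eps k
  heps0 : Filter.Tendsto eps Filter.atTop (nhds 0)
  qk : ℕ → ℝ
  hqk : ∀ k, 0 < qk k
  hqk_eq : ∀ k, 1 / (p + 1) + 1 / (qk k + 1) = ((n : ℝ) - 2) / n + eps k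
  u : ℕ → Euc n → ℝ
  v : ℕ → Euc n → ℝ
  hu_cont : ∀ k, ContinuousOn (u k) Ω
  hv_cont : ∀ k, ContinuousOn (v k) Ω
  hu_pos : ∀ k, ∀ x ∈ Ω, 0 < u k x
  hv_pos : ∀ k, ∀ x ∈ Ω, 0 < v k x
  hu_eq : ∀ k, ∀ x ∈ Ω, u k x = ∫ y in Ω, G x y * (v k y) ^ p
  hv_eq : ∀ k, ∀ x ∈ Ω, v k x = ∫ y in Ω, G x y * (u k y) ^ qk k
  lam : ℕ → ℝ
  xk : ℕ → Euc n
  hxk : ∀ k, xk k ∈ Ω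
  hlam_eq : ∀ k,
    lam k = max ((v k (xk k)) ^ ((p + 1) / n)) ((u k (xk k)) ^ ((qk k + 1) / n))
  hlam_sup : ∀ k, ∀ x ∈ Ω,
    max ((v k x) ^ ((p + 1) / n)) ((u k x) ^ ((qk k + 1) / n)) ≤ lam k
  hlam_top : Filter.Tendsto lam Filter.atTop Filter.atTop
  hN_top : Filter.Tendsto (fun k => lam k * (Metric.infDist (xk k) (frontier Ω) / 4))
    Filter.atTop Filter.atTop
  hlam_eps : ∃ C : ℝ, ∀ k, lam k ^ eps k ≤ C

namespace BlowupSetup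

variable {n : ℕ}

/-- `d_k = dist(x_k, ∂Ω)/4`. -/
noncomputable def d (S : BlowupSetup n) (k : ℕ) : ℝ :=
  Metric.infDist (S.xk k) (frontier S.Ω) / 4

/-- `N_k = λ_k d_k`. -/
noncomputable def N (S : BlowupSetup n) (k : ℕ) : ℝ := S.lam k * S.d k

end BlowupSetup

/-- The radial weight `(1 - |y|²)₊²`. -/
def quadBump (n : ℕ) (y : Euc n) : ℝ := (max (1 - ‖y‖ ^ 2) 0) ^ 2

/-- The radial function `(1 - |y|²)₊³`, whose gradient is `-6 y` times `quadBump`. -/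
def cubeBump (n : ℕ) (y : Euc n) : ℝ := (max (1 - ‖y‖ ^ 2) 0) ^ 3

lemma hasDerivAt_max_zero_cube (t : ℝ) :
    HasDerivAt (fun s : ℝ => (max s 0) ^ 3) (3 * (max t 0) ^ 2) t := by
  rcases lt_trichotomy t 0 with ht | rfl | ht
  · rw [max_eq_right ht.le]
    have : (fun s : ℝ => (max s 0) ^ 3) =ᶠ[𝓝 t] fun _ => (0 : ℝ) := by
      filter_upwards [gt_mem_nhds ht] with s hs
      simp [max_eq_right (le_of_lt hs)]
    simpa using (hasDerivAt_const t (0 : ℝ)).congr_of_eventuallyEq this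
  · rw [hasDerivAt_iff_isLittleO_nhds_zero]
    have : (fun h : ℝ => h ^ 3) =o[𝓝 0] fun h : ℝ => h := by
      simpa using (Asymptotics.isLittleO_pow_id (𝕜 := ℝ) (n := 3) (by norm_num))
    refine Asymptotics.IsBigO.trans_isLittleO ?_ this
    refine Asymptotics.IsBigO.of_bound 1 (Eventually.of_forall fun h => ?_)
    simp only [zero_add, max_self]
    norm_num
    refine pow_le_pow_left₀ (abs_nonneg _) ?_ 3
    rcases le_total h 0 with hh | hh
    · simp [max_eq_right hh]
    · simp [max_eq_left hh]
  · rw [max_eq_left ht.le]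
    have : (fun s : ℝ => (max s 0) ^ 3) =ᶠ[𝓝 t] fun s => s ^ 3 := by
      filter_upwards [lt_mem_nhds ht] with s hs
      simp [max_eq_left (le_of_lt hs)]
    simpa using (hasDerivAt_pow 3 t).congr_of_eventuallyEq this

lemma hasFDerivAt_cubeBump (n : ℕ) (y : Euc n) :
    HasFDerivAt (cubeBump n) ((-6 * quadBump n y) • innerSL ℝ y) y := by
  have h1 : HasFDerivAt (fun z : Euc n => 1 - ‖z‖ ^ 2) (-(2 • innerSL ℝ y)) y :=
    (hasStrictFDerivAt_norm_sq y).hasFDerivAt.const_sub 1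
  have h2 := (hasDerivAt_max_zero_cube (1 - ‖y‖ ^ 2)).comp_hasFDerivAt y h1
  refine h2.congr_fderiv ?_
  ext v
  simp [quadBump]
  ring

lemma continuous_quadBump (n : ℕ) : Continuous (quadBump n) := by
  unfold quadBump; fun_prop

lemma continuous_cubeBump (n : ℕ) : Continuous (cubeBump n) := by
  unfold cubeBump; fun_prop

lemma quadBump_eq_zero {n : ℕ} {y : Euc n} (hy : 1 ≤ ‖y‖) : quadBump n y = 0 := by
  unfold quadBump
  rw [max_eq_right (by nlinarith)]; norm_num

lemma cubeBump_eq_zero {n : ℕ} {y : Euc n} (hy : 1 ≤ ‖y‖) : cubeBump n y = 0 := by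
  unfold cubeBump
  rw [max_eq_right (by nlinarith)]; norm_num

lemma quadBump_nonneg {n : ℕ} (y : Euc n) : 0 ≤ quadBump n y := sq_nonneg _

lemma hasCompactSupport_quadBump (n : ℕ) : HasCompactSupport (quadBump n) :=
  HasCompactSupport.intro (isCompact_closedBall (0 : Euc n) 1) fun y hy =>
    quadBump_eq_zero (by simp at hy; exact hy.le)

lemma hasCompactSupport_cubeBump (n : ℕ) : HasCompactSupport (cubeBump n) :=
  HasCompactSupport.intro (isCompact_closedBall (0 : Euc n) 1) fun y hy =>
    cubeBump_eq_zero (by simp at hy; exact hy.le)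

lemma integral_quadBump_pos (n : ℕ) : 0 < ∫ y, quadBump n y := by
  refine (continuous_quadBump n).integral_pos_of_hasCompactSupport_nonneg_nonzero
    (hasCompactSupport_quadBump n) (fun y => quadBump_nonneg y) (x := 0) ?_
  simp [quadBump]

lemma abs_quadBump_sub_le {n : ℕ} {y z : Euc n} (hy : ‖y‖ ≤ 3) (hz : ‖z‖ ≤ 3) :
    |quadBump n y - quadBump n z| ≤ 12 * ‖y - z‖ := by
  have h1 : |max (1 - ‖y‖ ^ 2) 0 - max (1 - ‖z‖ ^ 2) 0| ≤ |(1 - ‖y‖ ^ 2) - (1 - ‖z‖ ^ 2)| :=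
    abs_max_sub_max_le_abs _ _ _
  have h2 : |(1 - ‖y‖ ^ 2) - (1 - ‖z‖ ^ 2)| ≤ 6 * ‖y - z‖ := by
    have h3 := abs_norm_sub_norm_le y z
    have : (1 - ‖y‖ ^ 2) - (1 - ‖z‖ ^ 2) = -((‖y‖ - ‖z‖) * (‖y‖ + ‖z‖)) := by ring
    rw [this, abs_neg, abs_mul, abs_of_nonneg (by positivity : 0 ≤ ‖y‖ + ‖z‖), mul_comm]
    have := norm_nonneg (y - z)
    have := norm_nonneg y
    have := norm_nonneg z
    exact mul_le_mul (by linarith) h3 (abs_nonneg _) (by norm_num)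
  have h4 : ∀ y : Euc n, max (1 - ‖y‖ ^ 2) 0 ≤ 1 ∧ 0 ≤ max (1 - ‖y‖ ^ 2) 0 := fun y =>
    ⟨max_le (by nlinarith [norm_nonneg y]) (by norm_num), le_max_right _ _⟩
  obtain ⟨a1, a0⟩ := h4 y
  obtain ⟨b1, b0⟩ := h4 z
  unfold quadBump
  rw [sq_sub_sq, abs_mul, abs_of_nonneg (by linarith)]
  have := abs_nonneg (max (1 - ‖y‖ ^ 2) 0 - max (1 - ‖z‖ ^ 2) 0)
  nlinarith

lemma integral_comp_mul_quadBump_of_contDiff {n : ℕ} {h : Euc n → ℝ} (hh : ContDiff ℝ 2 h)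
    (hc : HasCompactSupport h) {x : Euc n} {ρ : ℝ} (hρ : 0 ≤ ρ)
    (hl : ∀ z ∈ ball x ρ, lap n h z = 0) :
    ∫ y, h (x + ρ • y) * quadBump n y = h x * ∫ y, quadBump n y := by
  have hd : Differentiable ℝ h := hh.differentiable (by norm_num)
  have hf1 : ContDiff ℝ 1 (fderiv ℝ h) := hh.fderiv_right (by norm_num)
  have hg : ∀ i, ContDiff ℝ 1 (fun z => fderiv ℝ h z (EuclideanSpace.single i (1 : ℝ))) :=
    fun i => hf1.clm_apply contDiff_const
  obtain ⟨B, hB⟩ := (hc.fderiv (𝕜 := ℝ)).exists_bound_of_continuous hf1.continuous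
  have hB0 : 0 ≤ B := (norm_nonneg _).trans (hB 0)
  have hint : Integrable (quadBump n) :=
    (continuous_quadBump n).integrable_of_hasCompactSupport (hasCompactSupport_quadBump n)
  have hder : ∀ s : ℝ, HasDerivAt (fun s => ∫ y, h (x + s • y) * quadBump n y)
      (∫ y, fderiv ℝ h (x + s • y) y * quadBump n y) s := by
    intro s
    have hcont : ∀ s : ℝ, Continuous fun y : Euc n => h (x + s • y) * quadBump n y := fun s =>
      (hd.continuous.comp (by fun_prop)).mul (continuous_quadBump n)
    refine (hasDerivAt_integral_of_dominated_loc_of_deriv_le (s := Set.univ)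
      (F' := fun s y => fderiv ℝ h (x + s • y) y * quadBump n y)
      (bound := fun y => B * quadBump n y) univ_mem
      (Eventually.of_forall fun s => (hcont s).aestronglyMeasurable) ?_ ?_ ?_
      (hint.const_mul B) ?_).2
    · exact (hcont s).integrable_of_hasCompactSupport (hasCompactSupport_quadBump n).mul_left
    · have : Continuous fun y : Euc n => fderiv ℝ h (x + s • y) y * quadBump n y := by
        refine Continuous.mul ?_ (continuous_quadBump n)
        exact (hf1.continuous.comp (by fun_prop : Continuous fun y : Euc n => x + s • y)).clm_apply
          continuous_id
      exact this.aestronglyMeasurable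
    · refine Eventually.of_forall fun y s _ => ?_
      rcases le_total 1 ‖y‖ with hy | hy
      · simp [quadBump_eq_zero hy]
      · rw [norm_mul, Real.norm_of_nonneg (quadBump_nonneg y)]
        gcongr
        · exact quadBump_nonneg y
        · calc _ ≤ ‖fderiv ℝ h (x + s • y)‖ * ‖y‖ := ContinuousLinearMap.le_opNorm _ _
            _ ≤ B * 1 := by gcongr; exact hB _
            _ = B := mul_one B
    · refine Eventually.of_forall fun y s _ => ?_
      refine HasDerivAt.mul_const ?_ _
      have h1 : HasDerivAt (fun s : ℝ => x + s • y) y s := by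
        simpa using ((hasDerivAt_id s).smul_const y).const_add x
      exact (hd _).hasFDerivAt.comp_hasDerivAt s h1
  have hzero : ∀ s ∈ Set.Ico 0 ρ, ∫ y, fderiv ℝ h (x + s • y) y * quadBump n y = 0 := by
    intro s hs
    set g : Fin n → Euc n → ℝ := fun i y =>
      fderiv ℝ h (x + s • y) (EuclideanSpace.single i (1 : ℝ)) with hgdef
    have hgc : ∀ i, ContDiff ℝ 1 (g i) := fun i => (hg i).comp (by fun_prop)
    have hgd : ∀ i y, fderiv ℝ (g i) y (EuclideanSpace.single i 1) =
        s * fderiv ℝ (fun z => fderiv ℝ h z (EuclideanSpace.single i (1 : ℝ))) (x + s • y)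
          (EuclideanSpace.single i 1) := by
      intro i y
      have h1 : HasFDerivAt (fun y : Euc n => x + s • y) (s • ContinuousLinearMap.id ℝ (Euc n)) y :=
        ((hasFDerivAt_id y).const_smul s).const_add x
      have h2 := (((hg i).differentiable (by norm_num)) (x + s • y)).hasFDerivAt.comp y h1
      have h3 : fderiv ℝ (g i) y = _ := h2.fderiv
      rw [h3]
      simp
    have hpt : ∀ y, fderiv ℝ h (x + s • y) y * quadBump n y =
        ∑ i, (-1 / 6) * (g i y * fderiv ℝ (cubeBump n) y (EuclideanSpace.single i 1)) := by
      intro y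
      have hy : y = ∑ i, y i • EuclideanSpace.single i (1 : ℝ) := by
        ext j; simp [Finset.sum_apply, Pi.single_apply]
      have : fderiv ℝ h (x + s • y) y = ∑ i, y i * g i y := by
        conv_lhs => rw [hy]
        rw [map_sum]
        simp only [map_smul, smul_eq_mul]
        refine Finset.sum_congr rfl fun i _ => ?_
        rw [← hy]
      rw [this, Finset.sum_mul]
      refine Finset.sum_congr rfl fun i _ => ?_
      rw [(hasFDerivAt_cubeBump n y).fderiv]
      simp [EuclideanSpace.inner_single_right]
      ring
    have hcb : Differentiable ℝ (cubeBump n) := fun y =>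
      (hasFDerivAt_cubeBump n y).differentiableAt
    have hI : ∀ i, Integrable fun y =>
        g i y * fderiv ℝ (cubeBump n) y (EuclideanSpace.single i 1) := by
      intro i
      refine Continuous.integrable_of_hasCompactSupport ?_ ?_
      · refine (hgc i).continuous.mul ?_
        have : (fun y => fderiv ℝ (cubeBump n) y (EuclideanSpace.single i 1)) = fun y : Euc n =>
            (-6 * quadBump n y) * inner ℝ y (EuclideanSpace.single i 1) := by
          funext y; rw [(hasFDerivAt_cubeBump n y).fderiv]; simp
        rw [this]
        have := continuous_quadBump n
        fun_prop
      · exact ((hasCompactSupport_cubeBump n).fderiv_apply (𝕜 := ℝ) _).mul_left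
    have hI2 : ∀ i, Integrable fun y =>
        fderiv ℝ (g i) y (EuclideanSpace.single i 1) * cubeBump n y := fun i =>
      (((hgc i).continuous_fderiv (by norm_num)).clm_apply continuous_const |>.mul
        (continuous_cubeBump n)).integrable_of_hasCompactSupport
        (hasCompactSupport_cubeBump n).mul_left
    simp_rw [hpt]
    rw [integral_finsetSum _ fun i _ => (hI i).const_mul _]
    simp_rw [integral_const_mul _ _]
    have hibp : ∀ i, ∫ y, g i y * fderiv ℝ (cubeBump n) y (EuclideanSpace.single i 1) =
        -∫ y, fderiv ℝ (g i) y (EuclideanSpace.single i 1) * cubeBump n y := fun i =>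
      integral_mul_fderiv_eq_neg_fderiv_mul_of_integrable (hI2 i) (hI i)
        (((hgc i).continuous.mul (continuous_cubeBump n)).integrable_of_hasCompactSupport
          (hasCompactSupport_cubeBump n).mul_left)
        (fun y _ => (hgc i).differentiable (by norm_num) y) (fun y _ => hcb y)
    simp_rw [hibp]
    rw [← Finset.mul_sum, Finset.sum_neg_distrib, ← integral_finsetSum _ fun i _ => hI2 i]
    have : ∀ y, ∑ i, fderiv ℝ (g i) y (EuclideanSpace.single i 1) * cubeBump n y = 0 := by
      intro y
      rcases le_or_gt 1 ‖y‖ with hy | hy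
      · simp [cubeBump_eq_zero hy]
      · rw [← Finset.sum_mul]
        simp_rw [hgd]
        rw [← Finset.mul_sum]
        have : lap n h (x + s • y) = 0 := by
          refine hl _ ?_
          rw [mem_ball_iff_norm, add_sub_cancel_left, norm_smul, Real.norm_of_nonneg hs.1]
          rcases hs.1.eq_or_lt with h0 | h0
          · rw [← h0]; simpa [← h0] using hs.2
          · nlinarith [hs.2]
        rw [lap] at this
        rw [this]; simp
    simp [this]
  have := constant_of_has_deriv_right_zero (f := fun s => ∫ y, h (x + s • y) * quadBump n y)
    (a := 0) (b := ρ) (fun s _ => (hder s).continuousAt.continuousWithinAt)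
    (fun s hs => by
      have h1 := hder s
      rw [hzero s hs] at h1
      exact h1.hasDerivWithinAt) ρ ⟨hρ, le_rfl⟩
  simp only [zero_smul, add_zero, integral_const_mul] at this
  exact this

/-- Classical harmonicity on a set, with the coordinate Laplacian `lap`. -/
def HarmOn (n : ℕ) (h : Euc n → ℝ) (V : Set (Euc n)) : Prop :=
  ContDiffOn ℝ 2 h V ∧ ∀ z ∈ V, lap n h z = 0

lemma lap_congr {n : ℕ} {g h : Euc n → ℝ} {z : Euc n} (hgh : g =ᶠ[𝓝 z] h) :
    lap n g z = lap n h z := by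
  unfold lap
  refine Finset.sum_congr rfl fun i _ => ?_
  have : (fun y => fderiv ℝ g y (EuclideanSpace.single i (1 : ℝ))) =ᶠ[𝓝 z]
      fun y => fderiv ℝ h y (EuclideanSpace.single i 1) := by
    filter_upwards [hgh.fderiv (𝕜 := ℝ)] with y hy
    rw [hy]
  rw [this.fderiv_eq]

lemma HarmOn.mono {n : ℕ} {h : Euc n → ℝ} {V W : Set (Euc n)} (hh : HarmOn n h V) (hW : W ⊆ V) :
    HarmOn n h W :=
  ⟨hh.1.mono hW, fun z hz => hh.2 z (hW hz)⟩

lemma HarmOn.congr {n : ℕ} {g h : Euc n → ℝ} {V : Set (Euc n)} (hV : IsOpen V)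
    (hh : HarmOn n h V) (hgh : ∀ z ∈ V, g z = h z) : HarmOn n g V :=
  ⟨hh.1.congr hgh, fun z hz => (lap_congr (Filter.eventually_of_mem (hV.mem_nhds hz) hgh)).trans
    (hh.2 z hz)⟩

lemma ContDiffOn.differentiableAt_fderiv_apply {n : ℕ} {h : Euc n → ℝ} {V : Set (Euc n)}
    (hV : IsOpen V) (hh : ContDiffOn ℝ 2 h V) {z : Euc n} (hz : z ∈ V) (e : Euc n) :
    DifferentiableAt ℝ (fun y => fderiv ℝ h y e) z := by
  have h1 : ContDiffAt ℝ 1 (fderiv ℝ h) z :=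
    (hh.contDiffAt (hV.mem_nhds hz)).fderiv_right (by norm_num)
  exact (h1.differentiableAt (by norm_num)).clm_apply (differentiableAt_const e)

lemma HarmOn.differentiableAt {n : ℕ} {h : Euc n → ℝ} {V : Set (Euc n)}
    (hh : HarmOn n h V) (hV : IsOpen V) {z : Euc n} (hz : z ∈ V) : DifferentiableAt ℝ h z :=
  (hh.1.contDiffAt (hV.mem_nhds hz)).differentiableAt (by norm_num)

lemma HarmOn.sub {n : ℕ} {g h : Euc n → ℝ} {V : Set (Euc n)} (hV : IsOpen V)
    (hg : HarmOn n g V) (hh : HarmOn n h V) : HarmOn n (fun z => g z - h z) V := by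
  refine ⟨hg.1.sub hh.1, fun z hz => ?_⟩
  have h1 := hg.2 z hz
  have h2 := hh.2 z hz
  unfold lap at *
  refine Eq.trans ?_ ((congrArg₂ (· - ·) h1 h2).trans (sub_zero 0))
  rw [← Finset.sum_sub_distrib]
  refine Finset.sum_congr rfl fun i _ => ?_
  have : (fun y => fderiv ℝ (fun z => g z - h z) y (EuclideanSpace.single i (1 : ℝ))) =ᶠ[𝓝 z]
      fun y => fderiv ℝ g y (EuclideanSpace.single i 1) -
        fderiv ℝ h y (EuclideanSpace.single i 1) := by
    filter_upwards [hV.mem_nhds hz] with y hy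
    rw [fderiv_fun_sub (hg.differentiableAt hV hy) (hh.differentiableAt hV hy)]
    rfl
  rw [this.fderiv_eq, fderiv_fun_sub (hg.1.differentiableAt_fderiv_apply hV hz _)
    (hh.1.differentiableAt_fderiv_apply hV hz _)]
  rfl

lemma HarmOn.const_mul {n : ℕ} {h : Euc n → ℝ} {V : Set (Euc n)} (hV : IsOpen V)
    (hh : HarmOn n h V) (c : ℝ) : HarmOn n (fun z => c * h z) V := by
  refine ⟨contDiffOn_const.mul hh.1, fun z hz => ?_⟩
  have h2 := hh.2 z hz
  unfold lap at *
  rw [← mul_zero c, ← h2, Finset.mul_sum]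
  refine Finset.sum_congr rfl fun i _ => ?_
  have : (fun y => fderiv ℝ (fun z => c * h z) y (EuclideanSpace.single i (1 : ℝ))) =ᶠ[𝓝 z]
      fun y => c * fderiv ℝ h y (EuclideanSpace.single i 1) := by
    filter_upwards [hV.mem_nhds hz] with y hy
    rw [fderiv_const_mul (hh.differentiableAt hV hy)]
    rfl
  rw [this.fderiv_eq, fderiv_const_mul (hh.1.differentiableAt_fderiv_apply hV hz _)]
  rfl

lemma harmOn_norm_sub_rpow (n : ℕ) (y : Euc n) :
    HarmOn n (fun z => ‖z - y‖ ^ ((2 : ℝ) - n)) {y}ᶜ := by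
  set a : ℝ := ((2 : ℝ) - n) / 2 with ha
  have hN : ∀ z : Euc n, HasFDerivAt (fun z : Euc n => ‖z - y‖ ^ 2)
      (2 • innerSL ℝ (z - y)) z := fun z => by
    have h1 : HasFDerivAt (fun z : Euc n => z - y) (ContinuousLinearMap.id ℝ (Euc n)) z :=
      (hasFDerivAt_id z).sub_const y
    exact (hasStrictFDerivAt_norm_sq (z - y)).hasFDerivAt.comp z h1
  have hpos : ∀ z ∈ ({y}ᶜ : Set (Euc n)), 0 < ‖z - y‖ ^ 2 := fun z hz => by
    have : z - y ≠ 0 := sub_ne_zero.2 hz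
    positivity
  have hr : ∀ (b : ℝ), ∀ z ∈ ({y}ᶜ : Set (Euc n)), HasFDerivAt
      (fun z : Euc n => (‖z - y‖ ^ 2) ^ b)
      ((b * (‖z - y‖ ^ 2) ^ (b - 1)) • (2 • innerSL ℝ (z - y))) z := fun b z hz =>
    (hN z).rpow_const (Or.inl (hpos z hz).ne')
  refine HarmOn.congr isOpen_compl_singleton (h := fun z => (‖z - y‖ ^ 2) ^ a) ?_ ?_
  · refine ⟨?_, fun z hz => ?_⟩
    · refine ContDiffOn.rpow_const_of_ne ?_ fun z hz => (hpos z hz).ne'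
      exact ((contDiff_id.sub contDiff_const).norm_sq ℝ).contDiffOn
    · have hterm : ∀ i : Fin n, fderiv ℝ (fun x => fderiv ℝ (fun z => (‖z - y‖ ^ 2) ^ a) x
          (EuclideanSpace.single i 1)) z (EuclideanSpace.single i 1) =
          4 * a * (a - 1) * (‖z - y‖ ^ 2) ^ (a - 2) * (z i - y i) ^ 2
            + 2 * a * (‖z - y‖ ^ 2) ^ (a - 1) := by
        intro i
        have h1 : (fun x => fderiv ℝ (fun z => (‖z - y‖ ^ 2) ^ a) x
            (EuclideanSpace.single i (1 : ℝ))) =ᶠ[𝓝 z]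
            fun x => 2 * a * ((‖x - y‖ ^ 2) ^ (a - 1) * inner ℝ (EuclideanSpace.single i (1 : ℝ)) (x - y)) := by
          filter_upwards [isOpen_compl_singleton.mem_nhds hz] with x hx
          rw [(hr a x hx).fderiv]
          simp [EuclideanSpace.inner_single_right, EuclideanSpace.inner_single_left]
          ring
        have h2 : HasFDerivAt (fun x : Euc n => inner ℝ (EuclideanSpace.single i (1 : ℝ)) (x - y))
            (innerSL ℝ (EuclideanSpace.single i (1 : ℝ))) z := by
          have h1 : HasFDerivAt (fun z : Euc n => z - y) (ContinuousLinearMap.id ℝ (Euc n)) z :=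
            (hasFDerivAt_id z).sub_const y
          exact (innerSL ℝ (EuclideanSpace.single i (1 : ℝ))).hasFDerivAt.comp z h1
        have h3 : HasFDerivAt (fun x : Euc n => 2 * a * ((‖x - y‖ ^ 2) ^ (a - 1) *
            inner ℝ (EuclideanSpace.single i (1 : ℝ)) (x - y))) _ z :=
          ((hr (a - 1) z hz).mul h2).const_mul (2 * a)
        rw [h1.fderiv_eq, h3.fderiv]
        simp [EuclideanSpace.inner_single_right, EuclideanSpace.inner_single_left]
        rw [show a - 1 - 1 = a - 2 by ring]
        ring
      unfold lap
      simp_rw [hterm]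
      rw [Finset.sum_add_distrib, ← Finset.mul_sum]
      have hs : ∑ i, (z i - y i) ^ 2 = ‖z - y‖ ^ 2 := by
        rw [EuclideanSpace.norm_sq_eq]; simp
      rw [hs]
      have : (‖z - y‖ ^ 2) ^ (a - 1) = (‖z - y‖ ^ 2) ^ (a - 2) * ‖z - y‖ ^ 2 := by
        rw [show a - 1 = a - 2 + 1 by ring, Real.rpow_add (hpos z hz), Real.rpow_one]
      rw [this]
      simp
      rw [ha]
      ring
  · intro z hz
    rw [← Real.rpow_natCast, ← Real.rpow_mul (norm_nonneg _), ha]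
    congr 1
    push_cast; ring

lemma HarmOn.integral_comp_mul_quadBump {n : ℕ} {h : Euc n → ℝ} {x : Euc n} {ρ R : ℝ}
    (hρ : 0 < ρ) (hR : ρ < R) (hh : HarmOn n h (ball x R)) :
    Integrable (fun y => h (x + ρ • y) * quadBump n y) ∧
    ∫ y, h (x + ρ • y) * quadBump n y = h x * ∫ y, quadBump n y := by
  let f : ContDiffBump x := ⟨ρ, (ρ + R) / 2, hρ, by linarith⟩
  set g : Euc n → ℝ := fun z => f z * h z with hg
  have hgc : ContDiff ℝ 2 g := by
    rw [contDiff_iff_contDiffAt]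
    intro z
    by_cases hz : z ∈ ball x R
    · exact f.contDiff.contDiffAt.mul (hh.1.contDiffAt (isOpen_ball.mem_nhds hz))
    · have : g =ᶠ[𝓝 z] fun _ => 0 := by
        have hz' : z ∈ (closedBall x ((ρ + R) / 2))ᶜ := by
          simp only [mem_ball, not_lt, Set.mem_compl_iff, mem_closedBall, not_le] at hz ⊢
          linarith
        filter_upwards [isClosed_closedBall.isOpen_compl.mem_nhds hz'] with w hw
        have : f w = 0 := f.zero_of_le_dist (by
          simp only [Set.mem_compl_iff, mem_closedBall, not_le] at hw; exact hw.le)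
        simp [hg, this]
      exact contDiffAt_const.congr_of_eventuallyEq this
  have hgs : HasCompactSupport g := f.hasCompactSupport.mul_right
  have heq : ∀ z ∈ closedBall x ρ, g z = h z := fun z hz => by
    simp [hg, f.one_of_mem_closedBall hz]
  have hfun : (fun y => h (x + ρ • y) * quadBump n y) = fun y => g (x + ρ • y) * quadBump n y := by
    funext y
    rcases le_total 1 ‖y‖ with hy | hy
    · simp [quadBump_eq_zero hy]
    · rw [heq]
      rw [mem_closedBall_iff_norm, add_sub_cancel_left, norm_smul, Real.norm_of_nonneg hρ.le]
      nlinarith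
  rw [hfun]
  refine ⟨?_, ?_⟩
  · refine Continuous.integrable_of_hasCompactSupport ?_ (hasCompactSupport_quadBump n).mul_left
    exact (hgc.continuous.comp (by fun_prop)).mul (continuous_quadBump n)
  · rw [integral_comp_mul_quadBump_of_contDiff hgc hgs hρ.le, heq x (mem_closedBall_self hρ.le)]
    intro z hz
    rw [lap_congr (Filter.eventually_of_mem (isOpen_ball.mem_nhds hz)
      fun w hw => heq w (ball_subset_closedBall hw))]
    exact hh.2 z (ball_subset_ball hR.le hz)

/-- The constant in the interior Lipschitz estimate for harmonic functions. -/
def harmLip (n : ℕ) : ℝ := 24 * volume.real (ball (0 : Euc n) 2) / ∫ y, quadBump n y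

lemma harmLip_pos (n : ℕ) : 0 < harmLip n := by
  unfold harmLip
  have := integral_quadBump_pos n
  have : 0 < volume.real (ball (0 : Euc n) 2) :=
    ENNReal.toReal_pos (measure_ball_pos _ _ (by norm_num)).ne' measure_ball_lt_top.ne
  positivity

lemma HarmOn.abs_sub_le {n : ℕ} {h : Euc n → ℝ} {x z : Euc n} {r M : ℝ} (hr : 0 < r)
    (hh : HarmOn n h (ball x r)) (hM : ∀ w ∈ ball x r, |h w| ≤ M) (hz : ‖z - x‖ < r / 2) :
    |h z - h x| ≤ harmLip n * M / r * ‖z - x‖ := by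
  have hM0 : 0 ≤ M := (abs_nonneg _).trans (hM x (mem_ball_self hr))
  set ρ := r / 2 with hρdef
  have hρ : 0 < ρ := by positivity
  have hzz : HarmOn n h (ball z (r - ‖z - x‖)) := hh.mono (ball_subset_ball' (by
    rw [dist_eq_norm]; linarith))
  obtain ⟨i1, e1⟩ := hzz.integral_comp_mul_quadBump hρ (by linarith)
  obtain ⟨i2, e2⟩ := hh.integral_comp_mul_quadBump hρ (by linarith)
  set e : Euc n := ρ⁻¹ • (z - x) with he
  have hen : ‖e‖ = ‖z - x‖ / ρ := by
    rw [he, norm_smul, norm_inv, Real.norm_of_nonneg hρ.le]; field_simp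
  have he1 : ‖e‖ < 1 := by rw [hen, div_lt_one hρ]; exact hz
  have hshift : (fun y => h (z + ρ • (y - e)) * quadBump n (y - e)) =
      fun y => h (x + ρ • y) * quadBump n (y - e) := by
    funext y
    congr 2
    rw [he, smul_sub, smul_smul, mul_inv_cancel₀ hρ.ne', one_smul]; abel
  have i3 : Integrable (fun y => h (x + ρ • y) * quadBump n (y - e)) := by
    rw [← hshift]
    exact i1.comp_sub_right e
  have e3 : ∫ y, h (x + ρ • y) * quadBump n (y - e) = h z * ∫ y, quadBump n y := by
    rw [← e1, ← hshift]
    exact integral_sub_right_eq_self (fun y => h (z + ρ • y) * quadBump n y) e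
  have key : |(h z - h x) * ∫ y, quadBump n y| ≤
      M * (12 * ‖e‖) * volume.real (ball (0 : Euc n) 2) := by
    rw [sub_mul, ← e3, ← e2, ← integral_sub i3 i2, ← Real.norm_eq_abs]
    have hb : ∫ y, (ball (0 : Euc n) 2).indicator (fun _ => M * (12 * ‖e‖)) y =
        M * (12 * ‖e‖) * volume.real (ball (0 : Euc n) 2) := by
      rw [integral_indicator measurableSet_ball, setIntegral_const, smul_eq_mul, mul_comm]
    rw [← hb]
    refine norm_integral_le_of_norm_le ?_ (Eventually.of_forall fun y => ?_)
    · exact (integrable_indicator_iff measurableSet_ball).2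
        (integrableOn_const measure_ball_lt_top.ne)
    · by_cases hy : y ∈ ball (0 : Euc n) 2
      · rw [Set.indicator_of_mem hy, ← mul_sub, Real.norm_eq_abs, abs_mul]
        rw [mem_ball_zero_iff] at hy
        refine mul_le_mul (hM _ ?_) ?_ (abs_nonneg _) hM0
        · rw [mem_ball_iff_norm, add_sub_cancel_left, norm_smul, Real.norm_of_nonneg hρ.le]
          nlinarith
        · have := abs_quadBump_sub_le (y := y - e) (z := y)
            ((norm_sub_le _ _).trans (by linarith)) (by linarith)
          simpa using this
      · rw [Set.indicator_of_notMem hy]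
        rw [mem_ball_zero_iff, not_lt] at hy
        have h1 : 1 ≤ ‖y - e‖ := by
          have := norm_sub_norm_le y e
          linarith
        rw [quadBump_eq_zero h1, quadBump_eq_zero (by linarith)]
        simp
  have hI := integral_quadBump_pos n
  rw [abs_mul, abs_of_pos hI] at key
  rw [← le_div_iff₀ hI] at key
  refine key.trans (le_of_eq ?_)
  rw [hen, harmLip, hρdef]
  field_simp
  ring

/-- The constant `n |B₁|` of polar coordinates. -/
def polarConst (n : ℕ) : ℝ := n * volume.real (ball (0 : Euc n) 1)

lemma polarConst_pos {n : ℕ} (hn : 0 < n) : 0 < polarConst n := by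
  unfold polarConst
  have : 0 < volume.real (ball (0 : Euc n) 1) :=
    ENNReal.toReal_pos (measure_ball_pos _ _ (by norm_num)).ne' measure_ball_lt_top.ne
  positivity

lemma radial_rpow {n : ℕ} (hn : 0 < n) {s : Set ℝ} (hs : MeasurableSet s) (hs0 : s ⊆ Set.Ioi 0)
    (b : ℝ) (hi : IntegrableOn (fun t : ℝ => t ^ ((n : ℝ) - 1 + b)) s) (x : Euc n) :
    IntegrableOn (fun y : Euc n => ‖y - x‖ ^ b) {y | ‖y - x‖ ∈ s} ∧
    ∫ y in {y : Euc n | ‖y - x‖ ∈ s}, ‖y - x‖ ^ b =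
      polarConst n * ∫ t in s, t ^ ((n : ℝ) - 1 + b) := by
  have : NeZero n := ⟨hn.ne'⟩
  have : Nontrivial (Euc n) := by
    refine Module.nontrivial_of_finrank_pos (R := ℝ) ?_
    simpa using hn
  have hm : MeasurableSet {y : Euc n | ‖y - x‖ ∈ s} :=
    (by fun_prop : Measurable fun y : Euc n => ‖y - x‖) hs
  set F : ℝ → ℝ := s.indicator fun t => t ^ b with hF
  have hind : {y : Euc n | ‖y - x‖ ∈ s}.indicator (fun y => ‖y - x‖ ^ b) =
      fun y => F ‖y - x‖ := by
    funext y
    by_cases hy : ‖y - x‖ ∈ s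
    · rw [Set.indicator_of_mem (by exact hy), hF, Set.indicator_of_mem hy]
    · rw [Set.indicator_of_notMem (by exact hy), hF, Set.indicator_of_notMem hy]
  have hfun : Set.EqOn (fun t : ℝ => t ^ (Module.finrank ℝ (Euc n) - 1) • F t)
      (s.indicator fun t => t ^ ((n : ℝ) - 1 + b)) (Set.Ioi 0) := by
    intro t ht
    by_cases hts : t ∈ s
    · simp only [hF, Set.indicator_of_mem hts, smul_eq_mul, finrank_euclideanSpace_fin]
      rw [Real.rpow_add ht, ← Real.rpow_natCast, Nat.cast_sub hn, Nat.cast_one]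
    · simp [hF, Set.indicator_of_notMem hts]
  constructor
  · rw [← integrable_indicator_iff hm, hind]
    refine Integrable.comp_sub_right (f := fun y => F ‖y‖) ?_ x
    rw [integrable_fun_norm_addHaar, integrableOn_congr_fun hfun measurableSet_Ioi]
    exact ((integrable_indicator_iff hs).2 hi).integrableOn
  · rw [← integral_indicator hm, hind, integral_sub_right_eq_self (fun y => F ‖y‖) x,
      integral_fun_norm_addHaar, setIntegral_congr_fun measurableSet_Ioi hfun,
      setIntegral_indicator hs, Set.inter_eq_right.2 hs0, polarConst]
    simp [mul_assoc]

lemma ball_rpow {n : ℕ} (hn : 0 < n) {a R : ℝ} (ha : a < n) (hR : 0 < R) (x : Euc n) :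
    IntegrableOn (fun y : Euc n => ‖y - x‖ ^ (-a)) (ball x R) ∧
    ∫ y in ball x R, ‖y - x‖ ^ (-a) = polarConst n / (n - a) * R ^ (n - a) := by
  have : NeZero n := ⟨hn.ne'⟩
  have : Nontrivial (Euc n) := by
    refine Module.nontrivial_of_finrank_pos (R := ℝ) ?_
    simpa using hn
  have h1 : IntegrableOn (fun t : ℝ => t ^ ((n : ℝ) - 1 + -a)) (Set.Ioo 0 R) :=
    (intervalIntegral.integrableOn_Ioo_rpow_iff hR).2 (by linarith)
  obtain ⟨h2, h3⟩ := radial_rpow hn measurableSet_Ioo (fun t ht => ht.1) (-a) h1 x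
  have hset : {y : Euc n | ‖y - x‖ ∈ Set.Ioo 0 R} = ball x R \ {x} := by
    ext y
    simp [dist_eq_norm, sub_eq_zero, and_comm]
  have hae : (ball x R \ {x} : Set (Euc n)) =ᵐ[volume] ball x R :=
    sdiff_null_ae_eq_self (measure_singleton x)
  rw [hset] at h2 h3
  refine ⟨h2.congr_set_ae hae.symm, ?_⟩
  rw [← setIntegral_congr_set hae, h3, ← integral_Ioc_eq_integral_Ioo,
    ← intervalIntegral.integral_of_le hR.le, integral_rpow (Or.inl (by linarith)),
    Real.zero_rpow (by linarith)]
  rw [show (n : ℝ) - 1 + -a + 1 = n - a by ring]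
  ring

lemma compl_ball_rpow {n : ℕ} (hn : 0 < n) {a R : ℝ} (ha : n < a) (hR : 0 < R) (x : Euc n) :
    IntegrableOn (fun y : Euc n => ‖y - x‖ ^ (-a)) (ball x R)ᶜ ∧
    ∫ y in (ball x R)ᶜ, ‖y - x‖ ^ (-a) = polarConst n / (a - n) * R ^ (n - a) := by
  have h1 : IntegrableOn (fun t : ℝ => t ^ ((n : ℝ) - 1 + -a)) (Set.Ici R) :=
    (integrableOn_Ici_iff_integrableOn_Ioi).2 (integrableOn_Ioi_rpow_of_lt (by linarith) hR)
  obtain ⟨h2, h3⟩ := radial_rpow hn measurableSet_Ici (fun t ht => hR.trans_le ht) (-a) h1 x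
  have hset : {y : Euc n | ‖y - x‖ ∈ Set.Ici R} = (ball x R)ᶜ := by
    ext y
    simp [dist_eq_norm]
  rw [hset] at h2 h3
  refine ⟨h2, ?_⟩
  rw [h3, integral_Ici_eq_integral_Ioi, integral_Ioi_rpow_of_lt (by linarith) hR,
    show (n : ℝ) - 1 + -a + 1 = n - a by ring, ← neg_sub a n, div_neg]
  ring

lemma shell_rpow {n : ℕ} (hn : 0 < n) {r R : ℝ} (hr : 0 < r) (hR : r ≤ R) (x : Euc n) :
    IntegrableOn (fun y : Euc n => ‖y - x‖ ^ (-(n : ℝ))) (ball x R \ ball x r) ∧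
    ∫ y in ball x R \ ball x r, ‖y - x‖ ^ (-(n : ℝ)) = polarConst n * Real.log (R / r) := by
  have h0 : ∀ t : ℝ, t ^ ((n : ℝ) - 1 + -(n : ℝ)) = t⁻¹ := fun t => by
    rw [show (n : ℝ) - 1 + -(n : ℝ) = -1 by ring, Real.rpow_neg_one]
  have h1 : IntegrableOn (fun t : ℝ => t ^ ((n : ℝ) - 1 + -(n : ℝ))) (Set.Ico r R) := by
    simp_rw [h0]
    refine (ContinuousOn.integrableOn_Icc ?_).mono_set Set.Ico_subset_Icc_self
    exact continuousOn_inv₀.mono fun t ht => (hr.trans_le ht.1).ne'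
  obtain ⟨h2, h3⟩ := radial_rpow hn measurableSet_Ico (fun t ht => hr.trans_le ht.1)
    (-(n : ℝ)) h1 x
  have hset : {y : Euc n | ‖y - x‖ ∈ Set.Ico r R} = ball x R \ ball x r := by
    ext y
    simp [dist_eq_norm, and_comm]
  rw [hset] at h2 h3
  refine ⟨h2, ?_⟩
  rw [h3, integral_Ico_eq_integral_Ioo, ← integral_Ioc_eq_integral_Ioo,
    ← intervalIntegral.integral_of_le hR]
  simp_rw [h0]
  rw [integral_inv_of_pos hr (hr.trans_le hR)]

/-- Interaction of a singularity at `x` with the tail of the critical power at `x₀`. -/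
lemma exists_two_center_bound (n : ℕ) {a : ℝ} (ha0 : 0 < a) (ha : a < n) :
    ∃ C : ℝ, 0 < C ∧ ∀ (d : ℝ) (x x₀ : Euc n), 0 < d → ‖x - x₀‖ = 2 * d →
      IntegrableOn (fun y => ‖x - y‖ ^ (-a) * ‖y - x₀‖ ^ (-(n : ℝ))) (ball x₀ d)ᶜ ∧
      ∫ y in (ball x₀ d)ᶜ, ‖x - y‖ ^ (-a) * ‖y - x₀‖ ^ (-(n : ℝ)) ≤ C * d ^ (-a) := by
  have hn' : (0 : ℝ) < n := ha0.trans ha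
  have hn : 0 < n := by exact_mod_cast hn'
  have hσ := polarConst_pos hn
  refine ⟨polarConst n / (n - a) + 5 ^ a * (polarConst n / a),
    add_pos (div_pos hσ (by linarith)) (by positivity), ?_⟩
  intro d x x₀ hd hx
  obtain ⟨i1, e1⟩ := ball_rpow hn ha hd x
  obtain ⟨i2, e2⟩ := compl_ball_rpow hn (a := n + a) (by linarith) hd x₀
  have hm : MeasurableSet (ball x₀ d)ᶜ := measurableSet_ball.compl
  set g : Euc n → ℝ := fun y => d ^ (-(n : ℝ)) * (ball x d).indicator (fun y => ‖y - x‖ ^ (-a)) y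
    + 5 ^ a * (ball x₀ d)ᶜ.indicator (fun y => ‖y - x₀‖ ^ (-((n : ℝ) + a))) y with hg
  have hgi : Integrable g :=
    (((integrable_indicator_iff measurableSet_ball).2 i1).const_mul _).add
      (((integrable_indicator_iff hm).2 i2).const_mul _)
  have hg0 : ∀ y, 0 ≤ g y := fun y => by
    refine add_nonneg (mul_nonneg (by positivity) (Set.indicator_nonneg (fun _ _ => by positivity) _))
      (mul_nonneg (by positivity) (Set.indicator_nonneg (fun _ _ => by positivity) _))
  have hle : ∀ y ∈ (ball x₀ d)ᶜ, ‖x - y‖ ^ (-a) * ‖y - x₀‖ ^ (-(n : ℝ)) ≤ g y := by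
    intro y hy
    have hy' : d ≤ ‖y - x₀‖ := by simpa [dist_eq_norm] using hy
    rw [hg]
    simp only
    rw [Set.indicator_of_mem hy]
    by_cases hyx : y ∈ ball x d
    · rw [Set.indicator_of_mem hyx, norm_sub_rev x y, mul_comm]
      have : ‖y - x₀‖ ^ (-(n : ℝ)) ≤ d ^ (-(n : ℝ)) :=
        Real.rpow_le_rpow_of_nonpos hd hy' (by linarith)
      have h2 : ‖y - x₀‖ ^ (-(n : ℝ)) * ‖y - x‖ ^ (-a) ≤ d ^ (-(n : ℝ)) * ‖y - x‖ ^ (-a) := by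
        gcongr
      have : 0 ≤ 5 ^ a * ‖y - x₀‖ ^ (-((n : ℝ) + a)) := by positivity
      linarith
    · rw [Set.indicator_of_notMem hyx, mul_zero, zero_add]
      have hyx' : d ≤ ‖y - x‖ := by simpa [dist_eq_norm] using hyx
      have h3 : ‖y - x₀‖ / 5 ≤ ‖x - y‖ := by
        have := norm_sub_le_norm_sub_add_norm_sub y x x₀
        rw [norm_sub_rev x y]; linarith
      have hpos : 0 < ‖y - x₀‖ := hd.trans_le hy'
      have h4 : ‖x - y‖ ^ (-a) ≤ (‖y - x₀‖ / 5) ^ (-a) :=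
        Real.rpow_le_rpow_of_nonpos (by positivity) h3 (by linarith)
      calc _ ≤ (‖y - x₀‖ / 5) ^ (-a) * ‖y - x₀‖ ^ (-(n : ℝ)) := by gcongr
        _ = _ := by
          rw [Real.div_rpow hpos.le (by norm_num), Real.rpow_neg (by norm_num : (0 : ℝ) ≤ 5),
            neg_add, Real.rpow_add hpos]
          field_simp
  have hint : IntegrableOn (fun y => ‖x - y‖ ^ (-a) * ‖y - x₀‖ ^ (-(n : ℝ))) (ball x₀ d)ᶜ := by
    refine Integrable.mono' hgi.integrableOn (by fun_prop) ?_
    refine (ae_restrict_iff' hm).2 (Eventually.of_forall fun y hy => ?_)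
    rw [Real.norm_of_nonneg (by positivity)]
    exact hle y hy
  refine ⟨hint, ?_⟩
  calc _ ≤ ∫ y in (ball x₀ d)ᶜ, g y := setIntegral_mono_on hint hgi.integrableOn hm hle
    _ ≤ ∫ y, g y := setIntegral_le_integral hgi (Eventually.of_forall hg0)
    _ = _ := by
      rw [hg, integral_add (((integrable_indicator_iff measurableSet_ball).2 i1).const_mul _)
        (((integrable_indicator_iff hm).2 i2).const_mul _), integral_const_mul,
        integral_const_mul, integral_indicator measurableSet_ball, integral_indicator hm, e1, e2,
        show (n : ℝ) - (n + a) = -a by ring, show (n : ℝ) + a - n = a by ring,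
        show (n : ℝ) - a = n + -a by ring, Real.rpow_add hd, Real.rpow_neg hd.le (n : ℝ)]
      have : d ^ (n : ℝ) ≠ 0 := (Real.rpow_pos_of_pos hd _).ne'
      field_simp

/-- The derivative at a point of a family of functions depending measurably on a parameter is
measurable in the parameter. -/
lemma aestronglyMeasurable_fderiv_param {n : ℕ} {μ : Measure (Euc n)} {f : Euc n → Euc n → ℝ}
    {x : Euc n} {r : ℝ} (hr : 0 < r) (hf : ∀ z ∈ ball x r, AEStronglyMeasurable (f z) μ)
    (hd : ∀ᵐ y ∂μ, DifferentiableAt ℝ (fun z => f z y) x) :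
    AEStronglyMeasurable (fun y => fderiv ℝ (fun z => f z y) x) μ := by
  have hv : ∀ v : Euc n, AEStronglyMeasurable (fun y => fderiv ℝ (fun z => f z y) x v) μ := by
    intro v
    set c : ℕ → ℝ := fun m => ((m : ℝ) + 1) * ((‖v‖ + 1) / r) with hc
    have hc0 : ∀ m, 0 < c m := fun m => by positivity
    have hct : Tendsto (fun m => ‖c m‖) atTop atTop := by
      simp_rw [fun m => Real.norm_of_nonneg (hc0 m).le]
      exact Tendsto.atTop_mul_const (by positivity)
        (tendsto_atTop_add_const_right _ _ tendsto_natCast_atTop_atTop)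
    refine aestronglyMeasurable_of_tendsto_ae (u := atTop)
      (f := fun (m : ℕ) y => c m • (f (x + (c m)⁻¹ • v) y - f x y)) ?_ ?_
    · intro m
      suffices hz : x + (c m)⁻¹ • v ∈ ball x r from
        ((hf _ hz).sub (hf x (mem_ball_self hr))).const_smul (c m)
      rw [mem_ball_iff_norm, add_sub_cancel_left, norm_smul, norm_inv,
        Real.norm_of_nonneg (hc0 m).le, inv_mul_lt_iff₀ (hc0 m), hc]
      have : ((m : ℝ) + 1) * ((‖v‖ + 1) / r) * r = ((m : ℝ) + 1) * (‖v‖ + 1) := by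
        field_simp
      simp only [this]
      nlinarith [norm_nonneg v, Nat.cast_nonneg (α := ℝ) m,
        mul_nonneg (Nat.cast_nonneg (α := ℝ) m) (norm_nonneg v)]
    · filter_upwards [hd] with y hy
      exact hy.hasFDerivAt.lim v hct
  have hsum : (fun y => fderiv ℝ (fun z => f z y) x) = fun y =>
      ∑ i, (fderiv ℝ (fun z => f z y) x (EuclideanSpace.single i (1 : ℝ))) •
        innerSL ℝ (EuclideanSpace.single i (1 : ℝ)) := by
    funext y
    ext v
    have hvv : v = ∑ i, v i • EuclideanSpace.single i (1 : ℝ) := by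
      ext j; simp [Finset.sum_apply, Pi.single_apply]
    conv_lhs => rw [hvv]
    rw [map_sum]
    simp [EuclideanSpace.inner_single_left, mul_comm]
  rw [hsum]
  exact Finset.aestronglyMeasurable_fun_sum _ fun i _ => (hv _).smul_const _

/-- Differentiation under the integral sign for kernels with a singularity of order `n - 2` on
the diagonal. -/
lemma differentiableAt_integral_of_weakly_singular {n : ℕ} (hn : 3 ≤ n) {Ω : Set (Euc n)}
    (hΩ : MeasurableSet Ω) {f : Euc n → Euc n → ℝ} {g : Euc n → ℝ} {x : Euc n} {r κ A : ℝ}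
    (hr : 0 < r) (hκ : 0 < κ) (hA : 0 ≤ A)
    (hint : ∀ z ∈ ball x r, IntegrableOn (f z) Ω)
    (hdiff : ∀ y ∈ Ω, y ≠ x → DifferentiableAt ℝ (fun z => f z y) x)
    (hnear : ∀ z ∈ ball x r, ∀ y ∈ Ω, κ * ‖y - x‖ < r → y ≠ z →
      |f z y| ≤ A * ‖z - y‖ ^ ((2 : ℝ) - n))
    (hg : IntegrableOn g Ω) (hg0 : ∀ y ∈ Ω, 0 ≤ g y)
    (hlip : ∀ y ∈ Ω, y ≠ x → ∀ z ∈ ball x r, ‖z - x‖ ≤ κ * ‖y - x‖ →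
      |f z y - f x y| ≤ g y * ‖z - x‖) :
    DifferentiableAt ℝ (fun z => ∫ y in Ω, f z y) x ∧
      ‖fderiv ℝ (fun z => ∫ y in Ω, f z y) x‖ ≤ ∫ y in Ω, g y := by
  have hn0 : 0 < n := by omega
  have hn3 : (3 : ℝ) ≤ n := by exact_mod_cast hn
  have : NeZero n := ⟨hn0.ne'⟩
  have : Nontrivial (Euc n) := by
    refine Module.nontrivial_of_finrank_pos (R := ℝ) ?_
    simpa using hn0
  set f' : Euc n → Euc n →L[ℝ] ℝ := fun y => fderiv ℝ (fun z => f z y) x with hf'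
  have hae : ∀ z : Euc n, ∀ᵐ y ∂(volume.restrict Ω), y ∈ Ω ∧ y ≠ z := fun z =>
    (ae_restrict_mem hΩ).and (ae_restrict_of_ae (by
      simp [ae_iff, measure_singleton]))
  have hf'le : ∀ y ∈ Ω, y ≠ x → ‖f' y‖ ≤ g y := by
    intro y hy hyx
    refine norm_fderiv_le_of_lip' ℝ (hg0 y hy) ?_
    have hpos : 0 < κ * ‖y - x‖ := mul_pos hκ (norm_pos_iff.2 (sub_ne_zero.2 hyx))
    filter_upwards [ball_mem_nhds x hr, ball_mem_nhds x hpos] with z hz hz2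
    exact hlip y hy hyx z hz (mem_ball_iff_norm.1 hz2).le
  have hmeas : AEStronglyMeasurable f' (volume.restrict Ω) :=
    aestronglyMeasurable_fderiv_param hr (fun z hz => (hint z hz).aestronglyMeasurable)
      ((hae x).mono fun y hy => hdiff y hy.1 hy.2)
  have hf'int : IntegrableOn f' Ω :=
    Integrable.mono' hg hmeas ((hae x).mono fun y hy => hf'le y hy.1 hy.2)
  set L : Euc n →L[ℝ] ℝ := ∫ y in Ω, f' y with hL
  have hLle : ‖L‖ ≤ ∫ y in Ω, g y :=
    norm_integral_le_of_norm_le hg ((hae x).mono fun y hy => hf'le y hy.1 hy.2)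
  suffices h : HasFDerivAt (fun z => ∫ y in Ω, f z y) L x from
    ⟨h.differentiableAt, by rw [h.fderiv]; exact hLle⟩
  set far : Euc n → Set (Euc n) := fun z => {y | ‖z - x‖ ≤ κ * ‖y - x‖} with hfar
  have hfarm : ∀ z, MeasurableSet (far z) := fun z =>
    measurableSet_le measurable_const (by fun_prop)
  set Q : Euc n → Euc n → ℝ := fun z y =>
    ‖z - x‖⁻¹ * ((far z).indicator (f z) y - f x y - f' y (z - x)) with hQ
  have hxb : x ∈ ball x r := mem_ball_self hr
  have hbint : IntegrableOn ((ball x (r / κ)).indicator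
      (fun y => A / κ * ‖y - x‖ ^ (-((n : ℝ) - 1)))) Ω :=
    ((integrable_indicator_iff measurableSet_ball).2
      (((ball_rpow hn0 (a := (n : ℝ) - 1) (by linarith) (div_pos hr hκ) x).1).const_mul
        _)).integrableOn
  have hQ0 : Tendsto (fun z => ∫ y in Ω, Q z y) (𝓝 x) (𝓝 0) := by
    have : (0 : ℝ) = ∫ y in Ω, (0 : ℝ) := by simp
    rw [this]
    refine tendsto_integral_filter_of_dominated_convergence
      (fun y => 2 * g y + (ball x (r / κ)).indicator
        (fun y => A / κ * ‖y - x‖ ^ (-((n : ℝ) - 1))) y) ?_ ?_ ((hg.const_mul 2).add hbint) ?_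
    · filter_upwards [ball_mem_nhds x hr] with z hz
      refine AEStronglyMeasurable.const_mul ?_ _
      refine (((hint z hz).aestronglyMeasurable.indicator (hfarm z)).sub
        (hint x hxb).aestronglyMeasurable).sub ?_
      exact hmeas.apply_continuousLinearMap _
    · filter_upwards [ball_mem_nhds x hr] with z hz
      filter_upwards [hae x] with y hy
      have hind0 : 0 ≤ (ball x (r / κ)).indicator
          (fun y => A / κ * ‖y - x‖ ^ (-((n : ℝ) - 1))) y :=
        Set.indicator_nonneg (fun _ _ => by positivity) _
      have hg0' := hg0 y hy.1
      rcases eq_or_ne z x with rfl | hzx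
      · simp only [hQ, sub_self, norm_zero, inv_zero, zero_mul]
        linarith
      have hzpos : 0 < ‖z - x‖ := norm_pos_iff.2 (sub_ne_zero.2 hzx)
      have hyne : 0 < ‖y - x‖ := norm_pos_iff.2 (sub_ne_zero.2 hy.2)
      have hder : |f' y (z - x)| ≤ g y * ‖z - x‖ :=
        ((f' y).le_opNorm _).trans (by gcongr; exact hf'le y hy.1 hy.2)
      rw [hQ]
      simp only
      rw [norm_mul, norm_inv, norm_norm, inv_mul_le_iff₀ hzpos, Real.norm_eq_abs]
      by_cases hyf : y ∈ far z
      · rw [Set.indicator_of_mem hyf]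
        have h1 := hlip y hy.1 hy.2 z hz hyf
        have h2 := abs_sub (f z y - f x y) (f' y (z - x))
        have := mul_nonneg hzpos.le hind0
        nlinarith
      · rw [Set.indicator_of_notMem hyf]
        have hyf' : κ * ‖y - x‖ < ‖z - x‖ := by simpa [hfar] using hyf
        have hzr : ‖z - x‖ < r := mem_ball_iff_norm.1 hz
        have hyb : y ∈ ball x (r / κ) := by
          rw [mem_ball_iff_norm, lt_div_iff₀ hκ]; linarith
        rw [Set.indicator_of_mem hyb]
        have h1 := hnear x hxb y hy.1 (hyf'.trans hzr) hy.2
        have h2 : |0 - f x y - f' y (z - x)| ≤ |f x y| + |f' y (z - x)| := by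
          have := abs_sub (0 - f x y) (f' y (z - x))
          simpa using this
        have h3 : ‖x - y‖ ^ ((2 : ℝ) - n) = ‖y - x‖ * ‖y - x‖ ^ (-((n : ℝ) - 1)) := by
          rw [norm_sub_rev, show (2 : ℝ) - n = 1 + -((n : ℝ) - 1) by ring, Real.rpow_add hyne,
            Real.rpow_one]
        have h4 : A * ‖x - y‖ ^ ((2 : ℝ) - n) ≤
            ‖z - x‖ * (A / κ * ‖y - x‖ ^ (-((n : ℝ) - 1))) := by
          rw [h3]
          calc _ = (κ * ‖y - x‖) * (A / κ * ‖y - x‖ ^ (-((n : ℝ) - 1))) := by field_simp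
            _ ≤ _ := by gcongr
        have := mul_nonneg hzpos.le hg0'
        nlinarith
    · filter_upwards [hae x] with y hy
      have hpos : 0 < κ * ‖y - x‖ := mul_pos hκ (norm_pos_iff.2 (sub_ne_zero.2 hy.2))
      have h1 := hasFDerivAt_iff_tendsto.1 (hdiff y hy.1 hy.2).hasFDerivAt
      rw [tendsto_zero_iff_norm_tendsto_zero]
      refine h1.congr' ?_
      filter_upwards [ball_mem_nhds x hpos] with z hz
      have hyf : y ∈ far z := (mem_ball_iff_norm.1 hz).le
      simp only [hQ]
      rw [Set.indicator_of_mem hyf, norm_mul, norm_inv, norm_norm]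
  set Nr : Euc n → ℝ := fun z => ‖z - x‖⁻¹ * ∫ y in Ω, (far z)ᶜ.indicator (f z) y with hNr
  have hN0 : Tendsto Nr (𝓝 x) (𝓝 0) := by
    set C := A * (polarConst n / 2 * (1 + κ⁻¹) ^ 2) with hC
    have hlim : Tendsto (fun z => C * ‖z - x‖) (𝓝 x) (𝓝 0) := by
      have : Continuous fun z : Euc n => C * ‖z - x‖ := by fun_prop
      simpa using this.tendsto x
    refine squeeze_zero_norm' ?_ hlim
    filter_upwards [ball_mem_nhds x hr] with z hz
    rcases eq_or_ne z x with rfl | hzx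
    · simp [hNr]
    have hzpos : 0 < ‖z - x‖ := norm_pos_iff.2 (sub_ne_zero.2 hzx)
    set R := (1 + κ⁻¹) * ‖z - x‖ with hR
    have hRpos : 0 < R := by positivity
    obtain ⟨i1, e1⟩ := ball_rpow hn0 (a := (n : ℝ) - 2) (by linarith) hRpos z
    have i2 := ((integrable_indicator_iff measurableSet_ball).2 (i1.const_mul A))
    have hle : ‖∫ y in Ω, (far z)ᶜ.indicator (f z) y‖ ≤
        ∫ y in Ω, (ball z R).indicator (fun y => A * ‖y - z‖ ^ (-((n : ℝ) - 2))) y := by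
      refine norm_integral_le_of_norm_le i2.integrableOn ?_
      filter_upwards [hae z] with y hy
      by_cases hyf : y ∈ far z
      · rw [Set.indicator_of_notMem (by simpa using hyf), norm_zero]
        exact Set.indicator_nonneg (fun _ _ => by positivity) _
      · rw [Set.indicator_of_mem (by exact hyf)]
        have hyf' : κ * ‖y - x‖ < ‖z - x‖ := by simpa [hfar] using hyf
        have hyb : y ∈ ball z R := by
          rw [mem_ball_iff_norm, hR, add_mul, one_mul]
          have h1 : ‖y - x‖ < κ⁻¹ * ‖z - x‖ := by
            rw [lt_inv_mul_iff₀ hκ]; exact hyf'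
          have h2 := norm_sub_le_norm_sub_add_norm_sub y x z
          rw [norm_sub_rev x z] at h2
          linarith
        rw [Set.indicator_of_mem hyb, Real.norm_eq_abs, norm_sub_rev, neg_sub]
        exact hnear z hz y hy.1 (hyf'.trans (mem_ball_iff_norm.1 hz)) hy.2
    have hle2 : ∫ y in Ω, (ball z R).indicator (fun y => A * ‖y - z‖ ^ (-((n : ℝ) - 2))) y ≤
        A * (polarConst n / 2 * R ^ 2) := by
      refine (setIntegral_le_integral i2 (Eventually.of_forall fun y =>
        Set.indicator_nonneg (fun _ _ => by positivity) _)).trans (le_of_eq ?_)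
      rw [integral_indicator measurableSet_ball, integral_const_mul, e1]
      rw [show (n : ℝ) - (n - 2) = 2 by ring, Real.rpow_two]
    rw [hNr]
    simp only
    rw [norm_mul, norm_inv, norm_norm, inv_mul_le_iff₀ hzpos]
    refine (hle.trans hle2).trans (le_of_eq ?_)
    rw [hR, hC]; ring
  rw [hasFDerivAt_iff_tendsto]
  have hsum := (hQ0.add hN0).norm
  rw [add_zero, norm_zero] at hsum
  refine hsum.congr' ?_
  filter_upwards [ball_mem_nhds x hr] with z hz
  have hi1 := (hint z hz).indicator (hfarm z)
  have hi2 := (hint z hz).indicator (hfarm z).compl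
  have hi3 : IntegrableOn (fun y => f' y (z - x)) Ω := hf'int.apply_continuousLinearMap _
  rw [← norm_norm (z - x), ← norm_inv, ← norm_mul]
  congr 1
  simp only [hNr, hQ]
  have hi12 : IntegrableOn (fun y => (far z).indicator (f z) y - f x y) Ω :=
    hi1.sub (hint x hxb)
  rw [integral_const_mul, integral_sub hi12 hi3,
    integral_sub hi1 (hint x hxb), hL, ContinuousLinearMap.integral_apply hf'int]
  have : ∫ y in Ω, f z y = (∫ y in Ω, (far z).indicator (f z) y) +
      ∫ y in Ω, (far z)ᶜ.indicator (f z) y := by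
    rw [← integral_add hi1 hi2]
    congr 1
    funext y
    rw [Set.indicator_self_add_compl_apply]
  rw [this]
  ring

namespace BlowupSetup

lemma ball_infDist_frontier_subset {n : ℕ} (S : BlowupSetup n) {y : Euc n} (hy : y ∈ S.Ω) :
    ball y (infDist y (frontier S.Ω)) ⊆ S.Ω := by
  rcases (ball y (infDist y (frontier S.Ω))).eq_empty_or_nonempty with he | hne
  · simp [he]
  have hpos : 0 < infDist y (frontier S.Ω) := by
    by_contra h
    rw [ball_eq_empty.2 (not_lt.1 h)] at hne
    exact Set.not_nonempty_empty hne
  refine IsPreconnected.subset_left_of_subset_union S.hΩo isClosed_closure.isOpen_compl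
    (Set.disjoint_compl_right_iff_subset.2 subset_closure) (fun z hz => ?_)
    ⟨y, mem_ball_self hpos, hy⟩ (convex_ball _ _).isPreconnected
  by_cases hzΩ : z ∈ S.Ω
  · exact Or.inl hzΩ
  refine Or.inr fun hzc => ?_
  have hzf : z ∈ frontier S.Ω := by
    rw [S.hΩo.frontier_eq]
    exact ⟨hzc, hzΩ⟩
  have := infDist_le_dist_of_mem (x := y) hzf
  rw [mem_ball, dist_comm] at hz
  linarith

lemma infDist_frontier_pos {n : ℕ} (hn : 3 ≤ n) (S : BlowupSetup n) {y : Euc n} (hy : y ∈ S.Ω) :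
    0 < infDist y (frontier S.Ω) := by
  have : Nonempty (Fin n) := ⟨⟨0, by omega⟩⟩
  have hne : (frontier S.Ω).Nonempty := by
    rw [nonempty_frontier_iff]
    refine ⟨⟨y, hy⟩, fun h => ?_⟩
    have := S.hΩb
    rw [h] at this
    exact NoncompactSpace.noncompact_univ (X := Euc n)
      (isCompact_of_isClosed_isBounded isClosed_univ this)
  rw [← isClosed_frontier.notMem_iff_infDist_pos hne, S.hΩo.frontier_eq]
  exact fun h => h.2 hy

lemma d_pos {n : ℕ} (hn : 3 ≤ n) (S : BlowupSetup n) (k : ℕ) : 0 < S.d k :=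
  div_pos (S.infDist_frontier_pos hn (S.hxk k)) (by norm_num)

lemma ball_subset {n : ℕ} (S : BlowupSetup n) (k : ℕ) : ball (S.xk k) (4 * S.d k) ⊆ S.Ω := by
  have : 4 * S.d k = infDist (S.xk k) (frontier S.Ω) := by rw [d]; ring
  rw [this]
  exact S.ball_infDist_frontier_subset (S.hxk k)

lemma cGreen_pos {n : ℕ} (hn : 3 ≤ n) (S : BlowupSetup n) : 0 < cGreen n := by
  obtain ⟨ε, hε, hb⟩ := Metric.isOpen_iff.1 S.hΩo _ (S.hxk 0)
  set e : Euc n := EuclideanSpace.single ⟨0, by omega⟩ (1 : ℝ)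
  have he : ‖e‖ = 1 := by simp [e]
  set y := S.xk 0 + (ε / 2) • e with hy
  have hxy : ‖S.xk 0 - y‖ = ε / 2 := by
    rw [hy, sub_add_cancel_left, norm_neg, norm_smul, he, mul_one, Real.norm_of_nonneg (by linarith)]
  have hyΩ : y ∈ S.Ω := hb (by rw [mem_ball', dist_eq_norm, hxy]; linarith)
  have hne : S.xk 0 ≠ y := by
    intro h
    rw [← h, sub_self, norm_zero] at hxy
    linarith
  have h := (S.Gpos _ (S.hxk 0) _ hyΩ hne).trans_le (S.Gle _ (S.hxk 0) _ hyΩ hne)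
  exact pos_of_mul_pos_left h (Real.rpow_nonneg (norm_nonneg _) _)

lemma lam_pos {n : ℕ} (S : BlowupSetup n) (k : ℕ) : 0 < S.lam k := by
  rw [S.hlam_eq]
  exact lt_max_of_lt_left (Real.rpow_pos_of_pos (S.hv_pos k _ (S.hxk k)) _)

lemma abs_G_le {n : ℕ} (S : BlowupSetup n) {x y : Euc n} (hx : x ∈ S.Ω) (hy : y ∈ S.Ω)
    (hxy : x ≠ y) : |S.G x y| ≤ cGreen n * ‖x - y‖ ^ ((2 : ℝ) - n) := by
  rw [abs_of_pos (S.Gpos x hx y hy hxy)]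
  exact S.Gle x hx y hy hxy

lemma harmOn_left {n : ℕ} (S : BlowupSetup n) {y : Euc n} (hy : y ∈ S.Ω) :
    HarmOn n (fun z => S.G z y) (S.Ω \ {y}) := by
  have ho : IsOpen (S.Ω \ {y}) := S.hΩo.sdiff isClosed_singleton
  refine HarmOn.congr ho (HarmOn.sub ho (HarmOn.const_mul ho
    ((harmOn_norm_sub_rpow n y).mono fun z hz => hz.2) (cGreen n))
    ((show HarmOn n (fun z => S.H z y) S.Ω from S.Hharm y hy).mono Set.sdiff_subset)) ?_
  intro z hz
  exact S.Gdecomp z hz.1 y hy hz.2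

lemma abs_G_sub_le_left {n : ℕ} (hn : 3 ≤ n) (S : BlowupSetup n) {y z z' : Euc n} {ρ : ℝ}
    (hρ : 0 < ρ) (hy : y ∈ S.Ω) (hz : ball z ρ ⊆ S.Ω) (hzy : 2 * ρ ≤ ‖z - y‖)
    (hz' : ‖z' - z‖ < ρ / 2) :
    |S.G z' y - S.G z y| ≤
      harmLip n * (cGreen n * 2 ^ ((n : ℝ) - 2) * ‖z - y‖ ^ ((2 : ℝ) - n)) / ρ * ‖z' - z‖ := by
  have hn' : (3 : ℝ) ≤ n := by exact_mod_cast hn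
  have hfar : ∀ w ∈ ball z ρ, ‖z - y‖ / 2 ≤ ‖w - y‖ := by
    intro w hw
    rw [mem_ball_iff_norm] at hw
    have : ‖z - y‖ ≤ ‖z - w‖ + ‖w - y‖ := norm_sub_le_norm_sub_add_norm_sub _ _ _
    rw [norm_sub_rev z w] at this
    linarith
  have hne : ∀ w ∈ ball z ρ, w ≠ y := by
    rintro w hw rfl
    have := hfar w hw
    rw [sub_self, norm_zero] at this
    linarith
  refine HarmOn.abs_sub_le (h := fun z => S.G z y) hρ
    ((S.harmOn_left hy).mono fun w hw => ⟨hz hw, hne w hw⟩) (fun w hw => ?_) hz'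
  refine (S.abs_G_le (hz hw) hy (hne w hw)).trans ?_
  rw [mul_assoc]
  refine mul_le_mul_of_nonneg_left ?_ (S.cGreen_pos hn).le
  have h0 : 0 < ‖z - y‖ := by linarith
  refine (Real.rpow_le_rpow_of_nonpos (by positivity) (hfar w hw) (by linarith)).trans (le_of_eq ?_)
  rw [Real.div_rpow h0.le (by norm_num), div_eq_mul_inv, ← Real.rpow_neg (by norm_num), mul_comm]
  congr 2; ring

lemma abs_G_sub_le_right {n : ℕ} (hn : 3 ≤ n) (S : BlowupSetup n) {x y y' : Euc n} {ρ : ℝ}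
    (hρ : 0 < ρ) (hx : x ∈ S.Ω) (hy : ball y ρ ⊆ S.Ω) (hxy : 2 * ρ ≤ ‖x - y‖)
    (hy' : ‖y' - y‖ < ρ / 2) :
    |S.G x y' - S.G x y| ≤
      harmLip n * (cGreen n * 2 ^ ((n : ℝ) - 2) * ‖x - y‖ ^ ((2 : ℝ) - n)) / ρ * ‖y' - y‖ := by
  rw [S.Gsymm x y', S.Gsymm x y, norm_sub_rev x y]
  exact S.abs_G_sub_le_left hn hρ hx hy (by rwa [norm_sub_rev]) hy'

/-- A constant in the estimate for `G z y - G z x₀`. -/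
def dipoleConst (n : ℕ) : ℝ := (2 * harmLip n + 4) * (cGreen n * 2 ^ ((n : ℝ) - 2))

lemma dipoleConst_pos {n : ℕ} (hn : 3 ≤ n) (S : BlowupSetup n) : 0 < dipoleConst n := by
  have := S.cGreen_pos hn
  have := harmLip_pos n
  unfold dipoleConst
  positivity

lemma abs_G_sub_center_le {n : ℕ} (hn : 3 ≤ n) (S : BlowupSetup n) {x₀ x y z : Euc n} {d : ℝ}
    (hd : 0 < d) (hb : ball x₀ (4 * d) ⊆ S.Ω) (hx : ‖x - x₀‖ = 2 * d) (hz : ‖z - x‖ < d / 4)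
    (hy : y ∈ ball x₀ d) :
    |S.G z y - S.G z x₀| ≤ dipoleConst n * d ^ ((1 : ℝ) - n) * ‖y - x₀‖ := by
  have hn' : (3 : ℝ) ≤ n := by exact_mod_cast hn
  have hc := S.cGreen_pos hn
  have hL := harmLip_pos n
  rw [mem_ball_iff_norm] at hy
  have hzx : ‖z - x₀‖ ≤ ‖z - x‖ + ‖x - x₀‖ := norm_sub_le_norm_sub_add_norm_sub _ _ _
  have hzx' : ‖x - x₀‖ ≤ ‖x - z‖ + ‖z - x₀‖ := norm_sub_le_norm_sub_add_norm_sub _ _ _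
  have hzy : ‖z - x₀‖ ≤ ‖z - y‖ + ‖y - x₀‖ := norm_sub_le_norm_sub_add_norm_sub _ _ _
  rw [norm_sub_rev x z] at hzx'
  have hzΩ : z ∈ S.Ω := hb (by rw [mem_ball_iff_norm]; linarith)
  have hyΩ : y ∈ S.Ω := hb (by rw [mem_ball_iff_norm]; linarith)
  have hx₀Ω : x₀ ∈ S.Ω := hb (mem_ball_self (by linarith))
  have hdd : d ^ ((1 : ℝ) - n) = d ^ ((2 : ℝ) - n) / d := by
    rw [← Real.rpow_sub_one hd.ne']; congr 1; ring
  have hmono : ∀ t : ℝ, d ≤ t → t ^ ((2 : ℝ) - n) ≤ d ^ ((2 : ℝ) - n) := fun t ht =>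
    Real.rpow_le_rpow_of_nonpos hd ht (by linarith)
  have hB : 0 < cGreen n * 2 ^ ((n : ℝ) - 2) := by positivity
  have hdp : 0 < d ^ ((2 : ℝ) - n) := by positivity
  by_cases hy4 : ‖y - x₀‖ < d / 4
  · refine (S.abs_G_sub_le_right hn (ρ := d / 2) (by linarith) hzΩ
      ((ball_subset_ball (by linarith)).trans hb) (by linarith) (by linarith)).trans ?_
    have h1 := hmono ‖z - x₀‖ (by linarith)
    calc harmLip n * (cGreen n * 2 ^ ((n : ℝ) - 2) * ‖z - x₀‖ ^ ((2 : ℝ) - n)) / (d / 2)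
          * ‖y - x₀‖
        ≤ harmLip n * (cGreen n * 2 ^ ((n : ℝ) - 2) * d ^ ((2 : ℝ) - n)) / (d / 2)
          * ‖y - x₀‖ := by gcongr
      _ = 2 * harmLip n * (cGreen n * 2 ^ ((n : ℝ) - 2)) * (d ^ ((2 : ℝ) - n) / d)
          * ‖y - x₀‖ := by field_simp
      _ ≤ _ := by
        rw [dipoleConst, hdd]
        gcongr
        linarith
  · push Not at hy4
    have hfar : ∀ t : ℝ, d / 2 ≤ t → cGreen n * t ^ ((2 : ℝ) - n) ≤
        cGreen n * 2 ^ ((n : ℝ) - 2) * d ^ ((2 : ℝ) - n) := by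
      intro t ht
      rw [mul_assoc]
      refine mul_le_mul_of_nonneg_left ?_ hc.le
      refine (Real.rpow_le_rpow_of_nonpos (by positivity) ht (by linarith)).trans (le_of_eq ?_)
      rw [Real.div_rpow hd.le (by norm_num), div_eq_mul_inv, ← Real.rpow_neg (by norm_num),
        mul_comm]
      congr 2; ring
    have hne1 : z ≠ y := by
      rintro rfl
      rw [sub_self, norm_zero] at hzy; linarith
    have hne2 : z ≠ x₀ := by
      rintro rfl
      rw [sub_self, norm_zero] at hzx'; linarith
    have h1 := (S.Gle z hzΩ y hyΩ hne1).trans (hfar _ (by linarith))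
    have h2 := (S.Gle z hzΩ x₀ hx₀Ω hne2).trans (hfar _ (by linarith))
    have h3 := S.Gpos z hzΩ y hyΩ hne1
    have h4 := S.Gpos z hzΩ x₀ hx₀Ω hne2
    have h5 : |S.G z y - S.G z x₀| ≤ cGreen n * 2 ^ ((n : ℝ) - 2) * d ^ ((2 : ℝ) - n) := by
      rw [abs_le]; constructor <;> linarith
    refine h5.trans ?_
    rw [dipoleConst, hdd]
    calc cGreen n * 2 ^ ((n : ℝ) - 2) * d ^ ((2 : ℝ) - n)
        = 4 * (cGreen n * 2 ^ ((n : ℝ) - 2)) * (d ^ ((2 : ℝ) - n) / d) * (d / 4) := by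
          field_simp
      _ ≤ _ := by
        gcongr
        linarith

lemma abs_G_sub_center_sub_le {n : ℕ} (hn : 3 ≤ n) (S : BlowupSetup n) {x₀ x y z : Euc n} {d : ℝ}
    (hd : 0 < d) (hb : ball x₀ (4 * d) ⊆ S.Ω) (hx : ‖x - x₀‖ = 2 * d) (hz : ‖z - x‖ < d / 8)
    (hy : y ∈ ball x₀ d) :
    |(S.G z y - S.G z x₀) - (S.G x y - S.G x x₀)| ≤
      4 * harmLip n * dipoleConst n * d ^ (-(n : ℝ)) * ‖y - x₀‖ * ‖z - x‖ := by
  have hdd : d ^ (-(n : ℝ)) = d ^ ((1 : ℝ) - n) / d := by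
    rw [← Real.rpow_sub_one hd.ne']; congr 1; ring
  have hyn := hy
  rw [mem_ball_iff_norm] at hyn
  have hyΩ : y ∈ S.Ω := hb (by rw [mem_ball_iff_norm]; linarith)
  have hx₀Ω : x₀ ∈ S.Ω := hb (mem_ball_self (by linarith))
  have hmem : ∀ w ∈ ball x (d / 4), w ∈ S.Ω ∧ w ∉ ball x₀ d := by
    intro w hw
    rw [mem_ball_iff_norm] at hw
    have hwx : ‖w - x₀‖ ≤ ‖w - x‖ + ‖x - x₀‖ := norm_sub_le_norm_sub_add_norm_sub _ _ _
    have hwx' : ‖x - x₀‖ ≤ ‖x - w‖ + ‖w - x₀‖ := norm_sub_le_norm_sub_add_norm_sub _ _ _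
    rw [norm_sub_rev x w] at hwx'
    refine ⟨hb (by rw [mem_ball_iff_norm]; linarith), ?_⟩
    rw [mem_ball_iff_norm]; linarith
  have hharm : HarmOn n (fun w => S.G w y - S.G w x₀) (ball x (d / 4)) := by
    refine HarmOn.sub isOpen_ball ((S.harmOn_left hyΩ).mono ?_) ((S.harmOn_left hx₀Ω).mono ?_)
    · rintro w hw
      refine ⟨(hmem w hw).1, ?_⟩
      rintro rfl
      exact (hmem w hw).2 hy
    · rintro w hw
      refine ⟨(hmem w hw).1, ?_⟩
      rintro rfl
      exact (hmem w hw).2 (mem_ball_self hd)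
  refine (HarmOn.abs_sub_le (by linarith) hharm (fun w hw => S.abs_G_sub_center_le hn hd hb hx
    (mem_ball_iff_norm.1 hw) hy) (by linarith)).trans (le_of_eq ?_)
  rw [hdd]; field_simp

lemma abs_G_sub_le_of_far {n : ℕ} (hn : 3 ≤ n) (S : BlowupSetup n) {x y z : Euc n} {d : ℝ}
    (hd : 0 < d) (hb : ball x d ⊆ S.Ω) (hy : y ∈ S.Ω) (hxy : y ≠ x) (hz : ‖z - x‖ < d / 4)
    (hzy : ‖z - x‖ < ‖y - x‖ / 4) :
    |S.G z y - S.G x y| ≤ 2 * harmLip n * (cGreen n * 2 ^ ((n : ℝ) - 2)) *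
      (‖x - y‖ ^ ((1 : ℝ) - n) + ‖x - y‖ ^ ((2 : ℝ) - n) / d) * ‖z - x‖ := by
  have hc := S.cGreen_pos hn
  have hL := harmLip_pos n
  have h0 : 0 < ‖x - y‖ := norm_pos_iff.2 (sub_ne_zero.2 hxy.symm)
  have hdd : ‖x - y‖ ^ ((1 : ℝ) - n) = ‖x - y‖ ^ ((2 : ℝ) - n) / ‖x - y‖ := by
    rw [← Real.rpow_sub_one h0.ne']; congr 1; ring
  rw [norm_sub_rev y x] at hzy
  have key : ∀ t : ℝ, 0 < t → t = ‖x - y‖ ∨ t = d →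
      harmLip n * (cGreen n * 2 ^ ((n : ℝ) - 2) * ‖x - y‖ ^ ((2 : ℝ) - n)) / (t / 2) * ‖z - x‖ ≤
      2 * harmLip n * (cGreen n * 2 ^ ((n : ℝ) - 2)) *
      (‖x - y‖ ^ ((1 : ℝ) - n) + ‖x - y‖ ^ ((2 : ℝ) - n) / d) * ‖z - x‖ := by
    intro t ht htt
    have : ‖x - y‖ ^ ((2 : ℝ) - n) / t ≤
        ‖x - y‖ ^ ((1 : ℝ) - n) + ‖x - y‖ ^ ((2 : ℝ) - n) / d := by
      rw [hdd]
      rcases htt with rfl | rfl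
      · exact le_add_of_nonneg_right (by positivity)
      · exact le_add_of_nonneg_left (by positivity)
    calc _ = 2 * harmLip n * (cGreen n * 2 ^ ((n : ℝ) - 2)) *
          (‖x - y‖ ^ ((2 : ℝ) - n) / t) * ‖z - x‖ := by field_simp
      _ ≤ _ := mul_le_mul_of_nonneg_right (mul_le_mul_of_nonneg_left this (by positivity))
          (norm_nonneg _)
  rcases le_total ‖x - y‖ d with h | h
  · exact (S.abs_G_sub_le_left hn (ρ := ‖x - y‖ / 2) (by linarith) hy
      ((ball_subset_ball (by linarith)).trans hb) (by linarith) (by linarith)).trans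
      (key _ h0 (Or.inl rfl))
  · exact (S.abs_G_sub_le_left hn (ρ := d / 2) (by linarith) hy
      ((ball_subset_ball (by linarith)).trans hb) (by linarith) (by linarith)).trans
      (key _ hd (Or.inr rfl))

end BlowupSetup

/-- Integrability and bound for the integral of a function defined separately inside and outside
of a measurable set. -/
lemma integral_indicator_add_indicator_le {n : ℕ} {B Ω : Set (Euc n)} (hB : MeasurableSet B)
    {a b : Euc n → ℝ} (ha : IntegrableOn a B) (hb : IntegrableOn b Bᶜ)
    (ha0 : ∀ y, 0 ≤ a y) (hb0 : ∀ y, 0 ≤ b y) :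
    IntegrableOn (fun y => B.indicator a y + Bᶜ.indicator b y) Ω ∧
      ∫ y in Ω, (B.indicator a y + Bᶜ.indicator b y) ≤ (∫ y in B, a y) + ∫ y in Bᶜ, b y := by
  have hi1 : Integrable (B.indicator a) := ha.integrable_indicator hB
  have hi2 : Integrable (Bᶜ.indicator b) := hb.integrable_indicator hB.compl
  have hi : Integrable (fun y => B.indicator a y + Bᶜ.indicator b y) := hi1.add hi2
  refine ⟨hi.integrableOn, ?_⟩
  refine (setIntegral_le_integral hi (Eventually.of_forall fun y => add_nonneg
    (Set.indicator_nonneg (fun _ _ => ha0 _) _)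
    (Set.indicator_nonneg (fun _ _ => hb0 _) _))).trans ?_
  rw [integral_add hi1 hi2, integral_indicator hB, integral_indicator hB.compl]

namespace BlowupSetup

lemma aestronglyMeasurable_G {n : ℕ} (hn : 3 ≤ n) (S : BlowupSetup n) {x : Euc n}
    (hx : x ∈ S.Ω) :
    AEStronglyMeasurable (fun y => S.G x y) (volume.restrict S.Ω) := by
  have : Nonempty (Fin n) := ⟨⟨0, by omega⟩⟩
  have ho : IsOpen (S.Ω \ {x}) := S.hΩo.sdiff isClosed_singleton
  have hc : ContinuousOn (fun y => S.G x y) (S.Ω \ {x}) := by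
    simp_rw [S.Gsymm x]
    exact (S.harmOn_left hx).1.continuousOn
  have hae : (S.Ω \ {x} : Set (Euc n)) =ᵐ[volume] S.Ω :=
    sdiff_null_ae_eq_self (measure_singleton x)
  rw [← Measure.restrict_congr_set hae]
  exact hc.aestronglyMeasurable ho.measurableSet

lemma integrableOn_G_mul {n : ℕ} (hn : 3 ≤ n) (S : BlowupSetup n) {z : Euc n} (hz : z ∈ S.Ω)
    {w : Euc n → ℝ} {W : ℝ} (hw : ContinuousOn w S.Ω) (hW : ∀ y ∈ S.Ω, |w y| ≤ W) :
    IntegrableOn (fun y => S.G z y * w y) S.Ω := by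
  have : Nonempty (Fin n) := ⟨⟨0, by omega⟩⟩
  have hn' : (3 : ℝ) ≤ n := by exact_mod_cast hn
  have hc := S.cGreen_pos hn
  obtain ⟨R, hR⟩ := S.hΩb.subset_ball z
  have hR0 : 0 < R := by
    have := hR hz
    rwa [mem_ball, dist_self] at this
  have hi := ((ball_rpow (n := n) (a := (n : ℝ) - 2) (by omega) (by linarith) hR0 z).1.mono_set
    hR).const_mul (cGreen n * W)
  refine Integrable.mono' hi ((S.aestronglyMeasurable_G hn hz).mul
    (hw.aestronglyMeasurable S.hΩo.measurableSet)) ?_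
  have hne : ∀ᵐ y ∂(volume.restrict S.Ω), y ≠ z :=
    ae_restrict_of_ae (by simp [ae_iff])
  filter_upwards [ae_restrict_mem S.hΩo.measurableSet, hne] with y hy hyz
  rw [Real.norm_eq_abs, abs_mul]
  calc |S.G z y| * |w y| ≤ (cGreen n * ‖z - y‖ ^ ((2 : ℝ) - n)) * W := by
        gcongr
        · exact S.abs_G_le hz hy hyz.symm
        · exact hW y hy
    _ = _ := by
        rw [norm_sub_rev, neg_sub]; ring

/-- The potential of a density `w` decaying like `P |y - x₀|⁻ⁿ`, with the mass of the ball
`B(x₀, d)` moved to the centre, on the sphere `|x - x₀| = 2 d`. -/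
lemma exists_far_field_bound {n : ℕ} (hn : 3 ≤ n) (S : BlowupSetup n) :
    ∃ C, 0 < C ∧ ∀ (x₀ x : Euc n) (d P W : ℝ) (w : Euc n → ℝ), 0 < d →
      ball x₀ (4 * d) ⊆ S.Ω → ‖x - x₀‖ = 2 * d → ContinuousOn w S.Ω →
      (∀ y ∈ S.Ω, 0 ≤ w y) → (∀ y ∈ S.Ω, w y ≤ W) → 0 ≤ P →
      (∀ y ∈ S.Ω, y ≠ x₀ → w y ≤ P * ‖y - x₀‖ ^ (-(n : ℝ))) →
      |∫ y in S.Ω, (S.G x y * w y - S.G x x₀ * (ball x₀ d).indicator w y)|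
        ≤ C * P * d ^ (-((n : ℝ) - 2)) ∧
      DifferentiableAt ℝ (fun z =>
        ∫ y in S.Ω, (S.G z y * w y - S.G z x₀ * (ball x₀ d).indicator w y)) x ∧
      ‖fderiv ℝ (fun z =>
        ∫ y in S.Ω, (S.G z y * w y - S.G z x₀ * (ball x₀ d).indicator w y)) x‖
        ≤ C * P * d ^ (-((n : ℝ) - 1)) := by
  have : Nonempty (Fin n) := ⟨⟨0, by omega⟩⟩
  have hn0 : 0 < n := by omega
  have hn' : (3 : ℝ) ≤ n := by exact_mod_cast hn
  have hc := S.cGreen_pos hn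
  have hL := harmLip_pos n
  have hD := dipoleConst_pos hn S
  have hσ := polarConst_pos hn0
  obtain ⟨T₂, hT₂, hT₂b⟩ := exists_two_center_bound n (a := (n : ℝ) - 2) (by linarith)
    (by linarith)
  obtain ⟨T₁, hT₁, hT₁b⟩ := exists_two_center_bound n (a := (n : ℝ) - 1) (by linarith)
    (by linarith)
  set E := 2 * harmLip n * (cGreen n * 2 ^ ((n : ℝ) - 2)) with hE
  have hE0 : 0 < E := by positivity
  set C₁ := dipoleConst n * polarConst n + cGreen n * T₂ with hC₁
  set C₂ := 4 * harmLip n * dipoleConst n * polarConst n + E * (T₁ + T₂) with hC₂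
  have hC₁0 : 0 < C₁ := by positivity
  have hC₂0 : 0 < C₂ := by positivity
  refine ⟨C₁ + C₂, by positivity, ?_⟩
  intro x₀ x d P W w hd hb hx hw hw0 hW hP hwP
  set B := ball x₀ d with hB
  have hBm : MeasurableSet B := measurableSet_ball
  have hBΩ : B ⊆ S.Ω := (ball_subset_ball (by linarith)).trans hb
  have hx₀Ω : x₀ ∈ S.Ω := hb (mem_ball_self (by linarith))
  have hxb : ball x d ⊆ S.Ω := by
    refine (ball_subset_ball' ?_).trans hb
    rw [dist_eq_norm, hx]; linarith
  have hxΩ : x ∈ S.Ω := hxb (mem_ball_self hd)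
  have hxx₀ : x ≠ x₀ := by
    rintro rfl
    rw [sub_self, norm_zero] at hx; linarith
  have hW0 : 0 ≤ W := (hw0 x hxΩ).trans (hW x hxΩ)
  have hWa : ∀ y ∈ S.Ω, |w y| ≤ W := fun y hy => by
    rw [abs_of_nonneg (hw0 y hy)]; exact hW y hy
  have hwB : IntegrableOn (B.indicator w) S.Ω := by
    have hfin : volume B < ⊤ := measure_ball_lt_top
    have : IntegrableOn w B := by
      have : IsFiniteMeasure (volume.restrict B) := ⟨by simpa using hfin⟩
      refine Integrable.of_bound ((hw.mono hBΩ).aestronglyMeasurable hBm) W ?_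
      filter_upwards [ae_restrict_mem hBm] with y hy
      exact hWa y (hBΩ hy)
    exact (this.integrable_indicator hBm).integrableOn
  have hint : ∀ z ∈ S.Ω, IntegrableOn
      (fun y => S.G z y * w y - S.G z x₀ * B.indicator w y) S.Ω := fun z hz =>
    (S.integrableOn_G_mul hn hz hw hWa).sub (hwB.const_mul _)
  have hmulB : ∀ y ∈ S.Ω, y ≠ x₀ → ‖y - x₀‖ * w y ≤ P * ‖y - x₀‖ ^ (-((n : ℝ) - 1)) := by
    intro y hy hyx
    have h0 : 0 < ‖y - x₀‖ := norm_pos_iff.2 (sub_ne_zero.2 hyx)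
    calc ‖y - x₀‖ * w y ≤ ‖y - x₀‖ * (P * ‖y - x₀‖ ^ (-(n : ℝ))) := by
          gcongr
          exact hwP y hy hyx
      _ = P * (‖y - x₀‖ ^ (-(n : ℝ)) * ‖y - x₀‖) := by ring
      _ = _ := by
          rw [← Real.rpow_add_one h0.ne']; congr 2; ring
  have hball := ball_rpow (n := n) (a := (n : ℝ) - 1) hn0 (by linarith) hd x₀
  rw [show (n : ℝ) - (n - 1) = 1 by ring, div_one, Real.rpow_one] at hball
  have htc₂ := hT₂b d x x₀ hd hx
  have htc₁ := hT₁b d x x₀ hd hx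
  refine ⟨?_, ?_⟩
  · have hg := integral_indicator_add_indicator_le (Ω := S.Ω) hBm
      (hball.1.const_mul (dipoleConst n * d ^ ((1 : ℝ) - n) * P))
      (htc₂.1.const_mul (cGreen n * P)) (fun y => by positivity) (fun y => by positivity)
    have hne : ∀ᵐ y ∂(volume.restrict S.Ω), y ≠ x₀ ∧ y ≠ x :=
      ae_restrict_of_ae ((show ∀ᵐ y : Euc n, y ≠ x₀ by simp [ae_iff]).and
        (show ∀ᵐ y : Euc n, y ≠ x by simp [ae_iff]))
    rw [← Real.norm_eq_abs]
    refine (norm_integral_le_of_norm_le hg.1 ?_).trans (hg.2.trans ?_)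
    · filter_upwards [ae_restrict_mem S.hΩo.measurableSet, hne] with y hy hyx
      rw [Real.norm_eq_abs]
      by_cases hyB : y ∈ B
      · rw [Set.indicator_of_mem hyB, Set.indicator_of_mem hyB,
          Set.indicator_of_notMem (show y ∉ Bᶜ from fun h => h hyB), add_zero, ← sub_mul, abs_mul,
          abs_of_nonneg (hw0 y hy)]
        calc |S.G x y - S.G x x₀| * w y
            ≤ (dipoleConst n * d ^ ((1 : ℝ) - n) * ‖y - x₀‖) * w y := by
              gcongr
              · exact hw0 y hy
              · exact S.abs_G_sub_center_le hn hd hb hx (by simpa using by linarith) hyB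
          _ = dipoleConst n * d ^ ((1 : ℝ) - n) * (‖y - x₀‖ * w y) := by ring
          _ ≤ dipoleConst n * d ^ ((1 : ℝ) - n) * (P * ‖y - x₀‖ ^ (-((n : ℝ) - 1))) := by
              exact mul_le_mul_of_nonneg_left (hmulB y hy hyx.1) (by positivity)
          _ = _ := by ring
      · rw [Set.indicator_of_notMem hyB, Set.indicator_of_notMem hyB,
          Set.indicator_of_mem (show y ∈ Bᶜ from hyB), zero_add, mul_zero, sub_zero, abs_mul,
          abs_of_nonneg (hw0 y hy)]
        calc |S.G x y| * w y ≤ (cGreen n * ‖x - y‖ ^ ((2 : ℝ) - n)) *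
              (P * ‖y - x₀‖ ^ (-(n : ℝ))) := by
              gcongr
              · exact hw0 y hy
              · exact S.abs_G_le hxΩ hy hyx.2.symm
              · exact hwP y hy hyx.1
          _ = _ := by rw [neg_sub]; ring
    · rw [integral_const_mul, integral_const_mul, hball.2]
      have hdd : d ^ ((1 : ℝ) - n) * d = d ^ (-((n : ℝ) - 2)) := by
        rw [← Real.rpow_add_one hd.ne']; congr 1; ring
      calc dipoleConst n * d ^ ((1 : ℝ) - n) * P * (polarConst n * d) +
            cGreen n * P * ∫ y in Bᶜ, ‖x - y‖ ^ (-((n : ℝ) - 2)) * ‖y - x₀‖ ^ (-(n : ℝ))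
          ≤ dipoleConst n * d ^ ((1 : ℝ) - n) * P * (polarConst n * d) +
            cGreen n * P * (T₂ * d ^ (-((n : ℝ) - 2))) := by
            gcongr
            exact htc₂.2
        _ = C₁ * P * d ^ (-((n : ℝ) - 2)) := by rw [hC₁, ← hdd]; ring
        _ ≤ _ := by gcongr; linarith
  · have hsum := (htc₁.1.add (htc₂.1.div_const d)).const_mul (E * P)
    have hg := integral_indicator_add_indicator_le (Ω := S.Ω) hBm
      (hball.1.const_mul (4 * harmLip n * dipoleConst n * d ^ (-(n : ℝ)) * P)) hsum
      (fun y => by positivity) (fun y => by simp only [Pi.add_apply]; positivity)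
    have hzmem : ∀ z ∈ ball x (d / 8), z ∈ S.Ω := fun z hz =>
      hxb (ball_subset_ball (by linarith) hz)
    refine And.imp id (fun h => h.trans (hg.2.trans ?_)) (differentiableAt_integral_of_weakly_singular hn
      S.hΩo.measurableSet (f := fun z y => S.G z y * w y - S.G z x₀ * B.indicator w y)
      (x := x) (r := d / 8) (κ := 1 / 8) (A := cGreen n * W) (by positivity) (by norm_num)
      (by positivity) (fun z hz => hint z (hzmem z hz)) ?_ ?_ hg.1 ?_ ?_)
    · simp only [Pi.add_apply]
      rw [integral_const_mul, integral_const_mul, hball.2,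
        integral_add htc₁.1 (htc₂.1.div_const d), integral_div]
      have hdd : d ^ (-(n : ℝ)) * d = d ^ (-((n : ℝ) - 1)) := by
        rw [← Real.rpow_add_one hd.ne']; congr 1; ring
      have hdd' : d ^ (-((n : ℝ) - 2)) / d = d ^ (-((n : ℝ) - 1)) := by
        rw [← Real.rpow_sub_one hd.ne']; congr 1; ring
      calc 4 * harmLip n * dipoleConst n * d ^ (-(n : ℝ)) * P * (polarConst n * d) +
            E * P * ((∫ y in Bᶜ, ‖x - y‖ ^ (-((n : ℝ) - 1)) * ‖y - x₀‖ ^ (-(n : ℝ))) +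
              (∫ y in Bᶜ, ‖x - y‖ ^ (-((n : ℝ) - 2)) * ‖y - x₀‖ ^ (-(n : ℝ))) / d)
          ≤ 4 * harmLip n * dipoleConst n * d ^ (-(n : ℝ)) * P * (polarConst n * d) +
            E * P * (T₁ * d ^ (-((n : ℝ) - 1)) + (T₂ * d ^ (-((n : ℝ) - 2))) / d) := by
            gcongr
            · exact htc₁.2
            · exact htc₂.2
        _ = C₂ * P * d ^ (-((n : ℝ) - 1)) := by
            rw [mul_div_assoc, hdd', hC₂, ← hdd]; ring
        _ ≤ _ := by gcongr; linarith
    · intro y hy hyx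
      have ho : ∀ y : Euc n, IsOpen (S.Ω \ {y}) := fun y => S.hΩo.sdiff isClosed_singleton
      have hd1 := (S.harmOn_left hy).differentiableAt (ho y) (z := x) ⟨hxΩ, hyx.symm⟩
      have hd2 := (S.harmOn_left hx₀Ω).differentiableAt (ho x₀) (z := x) ⟨hxΩ, hxx₀⟩
      exact (hd1.mul_const _).sub (hd2.mul_const _)
    · intro z hz y hy hyx hyz
      have hyB : y ∉ B := by
        intro h
        rw [hB, mem_ball_iff_norm] at h
        have : ‖x - x₀‖ ≤ ‖x - y‖ + ‖y - x₀‖ := norm_sub_le_norm_sub_add_norm_sub _ _ _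
        rw [norm_sub_rev x y] at this
        linarith
      rw [Set.indicator_of_notMem hyB, mul_zero, sub_zero, abs_mul]
      calc |S.G z y| * |w y| ≤ (cGreen n * ‖z - y‖ ^ ((2 : ℝ) - n)) * W := by
            gcongr
            · exact S.abs_G_le (hzmem z hz) hy hyz.symm
            · exact hWa y hy
        _ = _ := by ring
    · intro y _
      refine add_nonneg (Set.indicator_nonneg (fun _ _ => by positivity) _)
        (Set.indicator_nonneg (fun _ _ => ?_) _)
      simp only [Pi.add_apply]; positivity
    · intro y hy hyx z hz hzy
      rw [mem_ball_iff_norm] at hz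
      have hyx0 : 0 < ‖y - x‖ := norm_pos_iff.2 (sub_ne_zero.2 hyx)
      by_cases hyB : y ∈ B
      · rw [Set.indicator_of_mem hyB, Set.indicator_of_mem hyB,
          Set.indicator_of_notMem (show y ∉ Bᶜ from fun h => h hyB), add_zero]
        by_cases hyx₀ : y = x₀
        · rw [hyx₀, sub_self, sub_self, sub_self, abs_zero]
          positivity
        rw [show S.G z y * w y - S.G z x₀ * w y - (S.G x y * w y - S.G x x₀ * w y) =
          ((S.G z y - S.G z x₀) - (S.G x y - S.G x x₀)) * w y by ring, abs_mul,
          abs_of_nonneg (hw0 y hy)]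
        calc _ ≤ (4 * harmLip n * dipoleConst n * d ^ (-(n : ℝ)) * ‖y - x₀‖ * ‖z - x‖) * w y := by
              gcongr
              · exact hw0 y hy
              · exact S.abs_G_sub_center_sub_le hn hd hb hx hz hyB
          _ = 4 * harmLip n * dipoleConst n * d ^ (-(n : ℝ)) * (‖y - x₀‖ * w y) * ‖z - x‖ := by
              ring
          _ ≤ 4 * harmLip n * dipoleConst n * d ^ (-(n : ℝ)) *
                (P * ‖y - x₀‖ ^ (-((n : ℝ) - 1))) * ‖z - x‖ := by
              exact mul_le_mul_of_nonneg_right (mul_le_mul_of_nonneg_left (hmulB y hy hyx₀)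
                (by positivity)) (norm_nonneg _)
          _ = _ := by ring
      · have hyx₀ : y ≠ x₀ := by
          rintro rfl
          exact hyB (mem_ball_self hd)
        rw [Set.indicator_of_notMem hyB, Set.indicator_of_notMem hyB,
          Set.indicator_of_mem (show y ∈ Bᶜ from hyB), zero_add, mul_zero, sub_zero, mul_zero,
          sub_zero, ← sub_mul, abs_mul, abs_of_nonneg (hw0 y hy)]
        simp only [Pi.add_apply]
        calc |S.G z y - S.G x y| * w y
            ≤ (E * (‖x - y‖ ^ ((1 : ℝ) - n) + ‖x - y‖ ^ ((2 : ℝ) - n) / d) * ‖z - x‖) *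
              (P * ‖y - x₀‖ ^ (-(n : ℝ))) := by
              gcongr
              · exact hw0 y hy
              · exact S.abs_G_sub_le_of_far hn hd hxb hy hyx (by linarith) (by linarith)
              · exact hwP y hy hyx₀
          _ = _ := by rw [neg_sub, neg_sub]; ring

end BlowupSetup

namespace BlowupSetup

lemma p_pos {n : ℕ} (S : BlowupSetup n) : 0 < S.p := lt_of_lt_of_le one_pos S.hp

lemma two_sub_mul_p {n : ℕ} (hn : 3 ≤ n) (S : BlowupSetup n)
    (hp : S.p = (n : ℝ) / ((n : ℝ) - 2)) : ((2 : ℝ) - n) * S.p = -n := by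
  have hn' : (3 : ℝ) ≤ n := by exact_mod_cast hn
  have : (n : ℝ) - 2 ≠ 0 := by linarith
  rw [hp]; field_simp; ring

lemma div_mul_p {n : ℕ} (S : BlowupSetup n) :
    (n : ℝ) / (S.p + 1) * S.p = n - (n : ℝ) / (S.p + 1) := by
  have : S.p + 1 ≠ 0 := by linarith [S.p_pos]
  field_simp; ring

lemma continuousOn_v_rpow {n : ℕ} (S : BlowupSetup n) (k : ℕ) :
    ContinuousOn (fun y => S.v k y ^ S.p) S.Ω :=
  (S.hv_cont k).rpow_const fun y hy => Or.inl (S.hv_pos k y hy).ne'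

lemma v_rpow_le {n : ℕ} (hn : 3 ≤ n) (S : BlowupSetup n)
    (hp : S.p = (n : ℝ) / ((n : ℝ) - 2)) {C₀ : ℝ} (hC₀ : 0 < C₀) {k : ℕ}
    (hvbd : ∀ y ∈ S.Ω, S.v k y ≤ C₀ * S.lam k ^ ((n : ℝ) / (S.p + 1))
        * (1 + S.lam k * ‖y - S.xk k‖) ^ ((2 : ℝ) - n))
    {y : Euc n} (hy : y ∈ S.Ω) :
    S.v k y ^ S.p ≤ C₀ ^ S.p * S.lam k ^ (n - (n : ℝ) / (S.p + 1)) *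
      (1 + S.lam k * ‖y - S.xk k‖) ^ (-(n : ℝ)) := by
  have hl := S.lam_pos k
  have h1 : 0 < 1 + S.lam k * ‖y - S.xk k‖ := by positivity
  refine (Real.rpow_le_rpow (S.hv_pos k y hy).le (hvbd y hy) S.p_pos.le).trans (le_of_eq ?_)
  rw [Real.mul_rpow (by positivity) (by positivity), Real.mul_rpow hC₀.le (by positivity),
    ← Real.rpow_mul hl.le, ← Real.rpow_mul h1.le, S.div_mul_p, S.two_sub_mul_p hn hp]

lemma v_rpow_le_const {n : ℕ} (hn : 3 ≤ n) (S : BlowupSetup n)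
    (hp : S.p = (n : ℝ) / ((n : ℝ) - 2)) {C₀ : ℝ} (hC₀ : 0 < C₀) {k : ℕ}
    (hvbd : ∀ y ∈ S.Ω, S.v k y ≤ C₀ * S.lam k ^ ((n : ℝ) / (S.p + 1))
        * (1 + S.lam k * ‖y - S.xk k‖) ^ ((2 : ℝ) - n))
    {y : Euc n} (hy : y ∈ S.Ω) :
    S.v k y ^ S.p ≤ C₀ ^ S.p * S.lam k ^ (n - (n : ℝ) / (S.p + 1)) := by
  have hl := S.lam_pos k
  refine (S.v_rpow_le hn hp hC₀ hvbd hy).trans (mul_le_of_le_one_right (by positivity) ?_)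
  refine Real.rpow_le_one_of_one_le_of_nonpos ?_ (by simp)
  exact le_add_of_nonneg_right (by positivity)

lemma v_rpow_le_norm_rpow {n : ℕ} (hn : 3 ≤ n) (S : BlowupSetup n)
    (hp : S.p = (n : ℝ) / ((n : ℝ) - 2)) {C₀ : ℝ} (hC₀ : 0 < C₀) {k : ℕ}
    (hvbd : ∀ y ∈ S.Ω, S.v k y ≤ C₀ * S.lam k ^ ((n : ℝ) / (S.p + 1))
        * (1 + S.lam k * ‖y - S.xk k‖) ^ ((2 : ℝ) - n))
    {y : Euc n} (hy : y ∈ S.Ω) (hyx : y ≠ S.xk k) :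
    S.v k y ^ S.p ≤ C₀ ^ S.p * S.lam k ^ (-((n : ℝ) / (S.p + 1))) *
      ‖y - S.xk k‖ ^ (-(n : ℝ)) := by
  have hl := S.lam_pos k
  have h0 : 0 < ‖y - S.xk k‖ := norm_pos_iff.2 (sub_ne_zero.2 hyx)
  refine (S.v_rpow_le hn hp hC₀ hvbd hy).trans ?_
  have h1 : (1 + S.lam k * ‖y - S.xk k‖) ^ (-(n : ℝ)) ≤
      S.lam k ^ (-(n : ℝ)) * ‖y - S.xk k‖ ^ (-(n : ℝ)) := by
    rw [← Real.mul_rpow hl.le h0.le]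
    exact Real.rpow_le_rpow_of_nonpos (by positivity) (by linarith) (by simp)
  calc _ ≤ C₀ ^ S.p * S.lam k ^ (n - (n : ℝ) / (S.p + 1)) *
        (S.lam k ^ (-(n : ℝ)) * ‖y - S.xk k‖ ^ (-(n : ℝ))) := by gcongr
    _ = C₀ ^ S.p * (S.lam k ^ (n - (n : ℝ) / (S.p + 1)) * S.lam k ^ (-(n : ℝ))) *
        ‖y - S.xk k‖ ^ (-(n : ℝ)) := by ring
    _ = _ := by
      rw [← Real.rpow_add hl]; congr 3; ring

lemma integrableOn_v_rpow {n : ℕ} (hn : 3 ≤ n) (S : BlowupSetup n)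
    (hp : S.p = (n : ℝ) / ((n : ℝ) - 2)) {C₀ : ℝ} (hC₀ : 0 < C₀) {k : ℕ}
    (hvbd : ∀ y ∈ S.Ω, S.v k y ≤ C₀ * S.lam k ^ ((n : ℝ) / (S.p + 1))
        * (1 + S.lam k * ‖y - S.xk k‖) ^ ((2 : ℝ) - n)) :
    IntegrableOn (fun y => S.v k y ^ S.p) S.Ω := by
  have : IsFiniteMeasure (volume.restrict S.Ω) := ⟨by simpa using S.hΩb.measure_lt_top⟩
  refine Integrable.of_bound ((S.continuousOn_v_rpow k).aestronglyMeasurable S.hΩo.measurableSet)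
    (C₀ ^ S.p * S.lam k ^ (n - (n : ℝ) / (S.p + 1))) ?_
  filter_upwards [ae_restrict_mem S.hΩo.measurableSet] with y hy
  rw [Real.norm_of_nonneg (Real.rpow_nonneg (S.hv_pos k y hy).le _)]
  exact S.v_rpow_le_const hn hp hC₀ hvbd hy

lemma integral_ball_v_rpow_le {n : ℕ} (hn : 3 ≤ n) (S : BlowupSetup n)
    (hp : S.p = (n : ℝ) / ((n : ℝ) - 2)) {C₀ : ℝ} (hC₀ : 0 < C₀) {k : ℕ}
    (hvbd : ∀ y ∈ S.Ω, S.v k y ≤ C₀ * S.lam k ^ ((n : ℝ) / (S.p + 1))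
        * (1 + S.lam k * ‖y - S.xk k‖) ^ ((2 : ℝ) - n))
    (hN : 1 ≤ S.N k) :
    ∫ y in ball (S.xk k) (S.d k), S.v k y ^ S.p ≤
      C₀ ^ S.p * S.lam k ^ (-((n : ℝ) / (S.p + 1))) *
        (polarConst n / n + polarConst n * Real.log (S.N k)) := by
  have hn0 : 0 < n := by omega
  have hl := S.lam_pos k
  have hd := S.d_pos hn k
  have hld : (S.lam k)⁻¹ ≤ S.d k := by
    rw [inv_le_iff_one_le_mul₀ hl, mul_comm]; exact hN
  have hbΩ : ball (S.xk k) (S.d k) ⊆ S.Ω :=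
    (ball_subset_ball (by linarith)).trans (S.ball_subset k)
  have hsub : ball (S.xk k) (S.lam k)⁻¹ ⊆ ball (S.xk k) (S.d k) := ball_subset_ball hld
  have hint := (S.integrableOn_v_rpow hn hp hC₀ hvbd).mono_set hbΩ
  have hb0 := ball_rpow (n := n) (a := 0) hn0 (by positivity) (inv_pos.2 hl) (S.xk k)
  have hsh := shell_rpow hn0 (inv_pos.2 hl) hld (S.xk k)
  have hdec : ∫ y in ball (S.xk k) (S.d k), S.v k y ^ S.p =
      (∫ y in ball (S.xk k) (S.lam k)⁻¹, S.v k y ^ S.p) +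
        ∫ y in ball (S.xk k) (S.d k) \ ball (S.xk k) (S.lam k)⁻¹, S.v k y ^ S.p := by
    rw [← setIntegral_union Set.disjoint_sdiff_right (measurableSet_ball.diff measurableSet_ball)
      (hint.mono_set hsub) (hint.mono_set Set.sdiff_subset), Set.union_sdiff_cancel hsub]
  have h1 : ∫ y in ball (S.xk k) (S.lam k)⁻¹, S.v k y ^ S.p ≤
      C₀ ^ S.p * S.lam k ^ (-((n : ℝ) / (S.p + 1))) * (polarConst n / n) := by
    calc _ ≤ ∫ y in ball (S.xk k) (S.lam k)⁻¹, (C₀ ^ S.p * S.lam k ^ (n - (n : ℝ) / (S.p + 1))) *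
          ‖y - S.xk k‖ ^ (-(0 : ℝ)) := by
          refine setIntegral_mono_on (hint.mono_set hsub) (hb0.1.const_mul _) measurableSet_ball ?_
          intro y hy
          rw [neg_zero, Real.rpow_zero, mul_one]
          exact S.v_rpow_le_const hn hp hC₀ hvbd (hbΩ (hsub hy))
      _ = C₀ ^ S.p * (S.lam k ^ (n - (n : ℝ) / (S.p + 1)) * S.lam k ^ (-(n : ℝ))) *
          (polarConst n / n) := by
          rw [integral_const_mul, hb0.2, sub_zero, Real.inv_rpow hl.le, ← Real.rpow_neg hl.le]
          ring
      _ = _ := by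
          rw [← Real.rpow_add hl]; congr 3; ring
  have h2 : ∫ y in ball (S.xk k) (S.d k) \ ball (S.xk k) (S.lam k)⁻¹, S.v k y ^ S.p ≤
      C₀ ^ S.p * S.lam k ^ (-((n : ℝ) / (S.p + 1))) * (polarConst n * Real.log (S.N k)) := by
    have : S.N k = S.d k / (S.lam k)⁻¹ := by rw [N, div_inv_eq_mul, mul_comm]
    rw [this, ← hsh.2, ← integral_const_mul]
    refine setIntegral_mono_on (hint.mono_set Set.sdiff_subset) (hsh.1.const_mul _)
      (measurableSet_ball.diff measurableSet_ball) ?_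
    intro y hy
    refine S.v_rpow_le_norm_rpow hn hp hC₀ hvbd (hbΩ hy.1) ?_
    rintro rfl
    exact hy.2 (mem_ball_self (inv_pos.2 hl))
  rw [hdec, mul_add]
  exact add_le_add h1 h2

lemma integral_ball_v_rpow_pos {n : ℕ} (hn : 3 ≤ n) (S : BlowupSetup n) (k : ℕ)
    (hint : IntegrableOn (fun y => S.v k y ^ S.p) S.Ω) :
    0 < ∫ y in ball (S.xk k) (S.d k), S.v k y ^ S.p := by
  have hd := S.d_pos hn k
  have hbΩ : ball (S.xk k) (S.d k) ⊆ S.Ω :=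
    (ball_subset_ball (by linarith)).trans (S.ball_subset k)
  have hpos : ∀ y ∈ ball (S.xk k) (S.d k), 0 < S.v k y ^ S.p := fun y hy =>
    Real.rpow_pos_of_pos (S.hv_pos k y (hbΩ hy)) _
  rw [setIntegral_pos_iff_support_of_nonneg_ae _ (hint.mono_set hbΩ)]
  · have hsub : ball (S.xk k) (S.d k) ⊆ Function.support fun y => S.v k y ^ S.p :=
      fun y hy => (hpos y hy).ne'
    rw [Set.inter_eq_right.2 hsub]
    exact measure_ball_pos _ _ hd
  · filter_upwards [ae_restrict_mem measurableSet_ball] with y hy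
    exact (hpos y hy).le

lemma u_sub_mul_G_eq {n : ℕ} (hn : 3 ≤ n) (S : BlowupSetup n) (k : ℕ) {W : ℝ}
    (hW : ∀ y ∈ S.Ω, S.v k y ^ S.p ≤ W)
    (hint : IntegrableOn (fun y => S.v k y ^ S.p) S.Ω) {z : Euc n} (hz : z ∈ S.Ω) :
    S.u k z - (∫ y in ball (S.xk k) (S.d k), S.v k y ^ S.p) * S.G z (S.xk k) =
      ∫ y in S.Ω, (S.G z y * S.v k y ^ S.p -
        S.G z (S.xk k) * (ball (S.xk k) (S.d k)).indicator (fun y => S.v k y ^ S.p) y) := by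
  have hd := S.d_pos hn k
  have hbΩ : ball (S.xk k) (S.d k) ⊆ S.Ω :=
    (ball_subset_ball (by linarith)).trans (S.ball_subset k)
  have h1 := S.integrableOn_G_mul hn hz (S.continuousOn_v_rpow k) (W := W) fun y hy => by
    rw [abs_of_nonneg (Real.rpow_nonneg (S.hv_pos k y hy).le _)]; exact hW y hy
  have h2 : IntegrableOn ((ball (S.xk k) (S.d k)).indicator (fun y => S.v k y ^ S.p)) S.Ω :=
    hint.indicator measurableSet_ball
  rw [integral_sub h1 (h2.const_mul _), integral_const_mul, setIntegral_indicator
    measurableSet_ball, Set.inter_eq_right.2 hbΩ, S.hu_eq k z hz]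
  ring

/-- Value and gradient of `u_k` minus the mass of the ball `B(x_k, d_k)` times the kernel. -/
lemma exists_u_sub_mul_G_bound {n : ℕ} (hn : 3 ≤ n) (S : BlowupSetup n)
    (hp : S.p = (n : ℝ) / ((n : ℝ) - 2)) {C₀ : ℝ} (hC₀ : 0 < C₀)
    (hvbd : ∀ k, ∀ y ∈ S.Ω, S.v k y ≤ C₀ * S.lam k ^ ((n : ℝ) / (S.p + 1))
        * (1 + S.lam k * ‖y - S.xk k‖) ^ ((2 : ℝ) - n)) :
    ∃ C, 0 < C ∧ ∀ k (x : Euc n), ‖x - S.xk k‖ = 2 * S.d k →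
      |S.u k x - (∫ y in ball (S.xk k) (S.d k), S.v k y ^ S.p) * S.G x (S.xk k)|
          ≤ C * S.lam k ^ (-((n : ℝ) / (S.p + 1))) * S.d k ^ (-((n : ℝ) - 2)) ∧
      ‖gradient (S.u k) x - (∫ y in ball (S.xk k) (S.d k), S.v k y ^ S.p) •
          gradient (fun z => S.G z (S.xk k)) x‖
          ≤ C * S.lam k ^ (-((n : ℝ) / (S.p + 1))) * S.d k ^ (-((n : ℝ) - 1)) := by
  obtain ⟨C, hC, hCb⟩ := S.exists_far_field_bound hn
  refine ⟨C * C₀ ^ S.p, by positivity, fun k x hx => ?_⟩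
  have hd := S.d_pos hn k
  have hl := S.lam_pos k
  have hint := S.integrableOn_v_rpow hn hp hC₀ (hvbd k)
  have hW := fun y hy => S.v_rpow_le_const hn hp hC₀ (hvbd k) (y := y) hy
  set K := ∫ y in ball (S.xk k) (S.d k), S.v k y ^ S.p with hK
  obtain ⟨h1, h2, h3⟩ := hCb (S.xk k) x (S.d k)
    (C₀ ^ S.p * S.lam k ^ (-((n : ℝ) / (S.p + 1)))) _ (fun y => S.v k y ^ S.p) hd
    (S.ball_subset k) hx (S.continuousOn_v_rpow k)
    (fun y hy => Real.rpow_nonneg (S.hv_pos k y hy).le _) hW (by positivity)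
    (fun y hy hyx => S.v_rpow_le_norm_rpow hn hp hC₀ (hvbd k) hy hyx)
  have hxΩ : x ∈ S.Ω := S.ball_subset k (by rw [mem_ball_iff_norm, hx]; linarith)
  have hxne : x ≠ S.xk k := by
    rintro rfl
    rw [sub_self, norm_zero] at hx; linarith
  have heq := fun z (hz : z ∈ S.Ω) => S.u_sub_mul_G_eq hn k hW hint hz
  constructor
  · rw [heq x hxΩ, mul_assoc C]
    exact h1
  · have ho : IsOpen (S.Ω \ {S.xk k}) := S.hΩo.sdiff isClosed_singleton
    have hG : DifferentiableAt ℝ (fun z => S.G z (S.xk k)) x :=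
      (S.harmOn_left (S.hxk k)).differentiableAt ho ⟨hxΩ, hxne⟩
    have hev : S.u k =ᶠ[𝓝 x] fun z => (∫ y in S.Ω, (S.G z y * S.v k y ^ S.p -
        S.G z (S.xk k) * (ball (S.xk k) (S.d k)).indicator (fun y => S.v k y ^ S.p) y)) +
        K * S.G z (S.xk k) := by
      filter_upwards [S.hΩo.mem_nhds hxΩ] with z hz
      rw [← heq z hz]; ring
    have hfd : fderiv ℝ (S.u k) x = fderiv ℝ (fun z => ∫ y in S.Ω, (S.G z y * S.v k y ^ S.p -
        S.G z (S.xk k) * (ball (S.xk k) (S.d k)).indicator (fun y => S.v k y ^ S.p) y)) x +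
        K • fderiv ℝ (fun z => S.G z (S.xk k)) x := by
      rw [hev.fderiv_eq, fderiv_fun_add h2 (hG.const_mul K), fderiv_const_mul hG]
    rw [gradient, gradient, hfd, map_add, map_smul, add_sub_cancel_right, mul_assoc C,
      LinearIsometryEquiv.norm_map]
    exact h3

end BlowupSetup

namespace BlowupSetup

lemma one_div_qk_add_one {n : ℕ} (S : BlowupSetup n) (k : ℕ) :
    1 / (S.qk k + 1) = ((n : ℝ) - 2) / n + S.eps k - 1 / (S.p + 1) := by
  linarith [S.hqk_eq k]

lemma qk_le_q {n : ℕ} (S : BlowupSetup n) (k : ℕ) : S.qk k ≤ S.q := by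
  have h1 := S.hqk_eq k
  have h2 := S.hpq
  have h3 := S.heps k
  have : 1 / (S.q + 1) ≤ 1 / (S.qk k + 1) := by linarith
  have h4 := (one_div_le_one_div (by linarith [S.hq]) (by linarith [S.hqk k])).1 this
  linarith

lemma div_mul_qk {n : ℕ} (hn : 3 ≤ n) (S : BlowupSetup n) (k : ℕ) :
    (n : ℝ) / (S.qk k + 1) * S.qk k = 2 + (n : ℝ) / (S.p + 1) - n * S.eps k := by
  have hn0 : (n : ℝ) ≠ 0 := by
    have : (3 : ℝ) ≤ n := by exact_mod_cast hn
    linarith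
  have hq : S.qk k + 1 ≠ 0 := by linarith [S.hqk k]
  calc (n : ℝ) / (S.qk k + 1) * S.qk k = n - n * (1 / (S.qk k + 1)) := by
        field_simp; ring
    _ = _ := by
        rw [one_div_qk_add_one]
        field_simp; ring

/-- The density `u_k ^ q_k` is of order `λ ^ (2 + n / (p + 1))` on the ball of radius `1 / λ`. -/
lemma exists_le_u_rpow {n : ℕ} (hn : 3 ≤ n) (S : BlowupSetup n)
    (U : Euc n → ℝ) (hUc : Continuous U) (hUpos : ∀ x, 0 < U x)
    (hUlim : TendstoUniformlyOn
      (fun k x => S.lam k ^ (-((n : ℝ) / (S.qk k + 1))) * S.u k ((S.lam k)⁻¹ • x + S.xk k))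
      U Filter.atTop (Metric.closedBall (0 : Euc n) 1)) :
    ∃ c, 0 < c ∧ ∀ᶠ k in atTop, ∀ y ∈ ball (S.xk k) (S.lam k)⁻¹,
      c * S.lam k ^ (2 + (n : ℝ) / (S.p + 1)) ≤ S.u k y ^ S.qk k := by
  obtain ⟨x₁, -, hx₁⟩ := (isCompact_closedBall (0 : Euc n) 1).exists_isMinOn
    ⟨0, mem_closedBall_self zero_le_one⟩ hUc.continuousOn
  obtain ⟨C₁, hC₁⟩ := S.hlam_eps
  have hC₁0 : 0 < C₁ := (Real.rpow_pos_of_pos (S.lam_pos 0) _).trans_le (hC₁ 0)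
  set m := min 1 (U x₁ / 2) with hm
  have hm0 : 0 < m := lt_min one_pos (half_pos (hUpos x₁))
  refine ⟨m ^ S.q * C₁ ^ (-(n : ℝ)), by positivity, ?_⟩
  filter_upwards [Metric.tendstoUniformlyOn_iff.1 hUlim m hm0] with k hk y hy
  have hl := S.lam_pos k
  rw [mem_ball_iff_norm] at hy
  have hyx : S.lam k • (y - S.xk k) ∈ closedBall (0 : Euc n) 1 := by
    rw [mem_closedBall_zero_iff, norm_smul, Real.norm_of_nonneg hl.le]
    calc S.lam k * ‖y - S.xk k‖ ≤ S.lam k * (S.lam k)⁻¹ := by gcongr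
      _ = 1 := mul_inv_cancel₀ hl.ne'
  have h1 := hk _ hyx
  have h2 : U x₁ ≤ U (S.lam k • (y - S.xk k)) := hx₁ hyx
  rw [inv_smul_smul₀ hl.ne', sub_add_cancel, Real.dist_eq] at h1
  have h3 := (abs_lt.1 h1).2
  have h4 : m ≤ U x₁ / 2 := min_le_right _ _
  have h5 : m ≤ S.lam k ^ (-((n : ℝ) / (S.qk k + 1))) * S.u k y := by linarith
  have h6 : m * S.lam k ^ ((n : ℝ) / (S.qk k + 1)) ≤ S.u k y := by
    rw [Real.rpow_neg hl.le, inv_mul_eq_div, le_div_iff₀ (by positivity)] at h5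
    exact h5
  calc m ^ S.q * C₁ ^ (-(n : ℝ)) * S.lam k ^ (2 + (n : ℝ) / (S.p + 1))
      ≤ m ^ S.qk k * (S.lam k ^ S.eps k) ^ (-(n : ℝ)) * S.lam k ^ (2 + (n : ℝ) / (S.p + 1)) := by
        have i1 : m ^ S.q ≤ m ^ S.qk k :=
          Real.rpow_le_rpow_of_exponent_ge hm0 (min_le_left _ _) (S.qk_le_q k)
        have i2 : C₁ ^ (-(n : ℝ)) ≤ (S.lam k ^ S.eps k) ^ (-(n : ℝ)) :=
          Real.rpow_le_rpow_of_nonpos (by positivity) (hC₁ k) (by simp)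
        gcongr
    _ = (m * S.lam k ^ ((n : ℝ) / (S.qk k + 1))) ^ S.qk k := by
        rw [Real.mul_rpow hm0.le (by positivity), ← Real.rpow_mul hl.le, ← Real.rpow_mul hl.le,
          S.div_mul_qk hn, mul_assoc, ← Real.rpow_add hl]
        congr 2; ring
    _ ≤ _ := Real.rpow_le_rpow (by positivity) h6 (S.hqk k).le

/-- Near the diagonal and away from the boundary, `G` is comparable to the fundamental solution. -/
lemma exists_le_G {n : ℕ} (hn : 3 ≤ n) (S : BlowupSetup n) {C₀ : ℝ} (hC₀ : 0 < C₀)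
    (hHbd : ∀ x ∈ S.Ω, ∀ y ∈ S.Ω, x ≠ y →
      S.H x y ≤ C₀ * Metric.infDist y (frontier S.Ω) ^ ((2 : ℝ) - n)) :
    ∃ δ, 0 < δ ∧ δ ≤ 1 ∧ ∀ k, ∀ x ∈ ball (S.xk k) (δ * S.d k),
      ∀ y ∈ ball (S.xk k) (δ * S.d k), x ≠ y →
      cGreen n / 2 * ‖x - y‖ ^ ((2 : ℝ) - n) ≤ S.G x y := by
  have hn' : (3 : ℝ) ≤ n := by exact_mod_cast hn
  have hc := S.cGreen_pos hn
  set t := min 1 (cGreen n / (2 * C₀)) with ht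
  have ht0 : 0 < t := lt_min one_pos (by positivity)
  have ht1 : t ≤ 1 := min_le_left _ _
  have htC : C₀ ≤ cGreen n / 2 * t ^ ((2 : ℝ) - n) := by
    have h1 : t ^ (-1 : ℝ) ≤ t ^ ((2 : ℝ) - n) :=
      Real.rpow_le_rpow_of_exponent_ge ht0 ht1 (by linarith)
    have h2 : C₀ ≤ cGreen n / 2 * t ^ (-1 : ℝ) := by
      have : t ≤ cGreen n / (2 * C₀) := min_le_right _ _
      rw [le_div_iff₀ (by positivity)] at this
      rw [Real.rpow_neg_one, ← div_eq_mul_inv, le_div_iff₀ ht0]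
      linarith
    exact h2.trans (by gcongr)
  refine ⟨t / 2, by positivity, by linarith, fun k x hx y hy hxy => ?_⟩
  have hd := S.d_pos hn k
  have hball : ball (S.xk k) (t / 2 * S.d k) ⊆ S.Ω :=
    (ball_subset_ball (by nlinarith)).trans (S.ball_subset k)
  have hxy0 : 0 < ‖x - y‖ := norm_pos_iff.2 (sub_ne_zero.2 hxy)
  have hinf : S.d k ≤ infDist y (frontier S.Ω) := by
    have h1 : infDist (S.xk k) (frontier S.Ω) ≤ infDist y (frontier S.Ω) + dist (S.xk k) y :=
      infDist_le_infDist_add_dist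
    have h2 : infDist (S.xk k) (frontier S.Ω) = 4 * S.d k := by rw [d]; ring
    rw [mem_ball'] at hy
    nlinarith
  have hH := hHbd x (hball hx) y (hball hy) hxy
  have h1 : infDist y (frontier S.Ω) ^ ((2 : ℝ) - n) ≤ S.d k ^ ((2 : ℝ) - n) :=
    Real.rpow_le_rpow_of_nonpos hd hinf (by linarith)
  have h2 : ‖x - y‖ ≤ t * S.d k := by
    have : ‖x - y‖ ≤ ‖x - S.xk k‖ + ‖S.xk k - y‖ := norm_sub_le_norm_sub_add_norm_sub _ _ _
    rw [mem_ball_iff_norm] at hx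
    rw [mem_ball_iff_norm'] at hy
    linarith
  have h3 : t ^ ((2 : ℝ) - n) * S.d k ^ ((2 : ℝ) - n) ≤ ‖x - y‖ ^ ((2 : ℝ) - n) := by
    rw [← Real.mul_rpow ht0.le hd.le]
    exact Real.rpow_le_rpow_of_nonpos hxy0 h2 (by linarith)
  have h4 : S.H x y ≤ cGreen n / 2 * ‖x - y‖ ^ ((2 : ℝ) - n) := by
    calc S.H x y ≤ C₀ * S.d k ^ ((2 : ℝ) - n) := hH.trans (by gcongr)
      _ ≤ (cGreen n / 2 * t ^ ((2 : ℝ) - n)) * S.d k ^ ((2 : ℝ) - n) := by gcongr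
      _ = cGreen n / 2 * (t ^ ((2 : ℝ) - n) * S.d k ^ ((2 : ℝ) - n)) := by ring
      _ ≤ _ := by gcongr
  rw [S.Gdecomp x (hball hx) y (hball hy) hxy]
  linarith

lemma integrableOn_G_mul_u_rpow {n : ℕ} (hn : 3 ≤ n) (S : BlowupSetup n) (k : ℕ) {x : Euc n}
    (hx : x ∈ S.Ω) : IntegrableOn (fun y => S.G x y * S.u k y ^ S.qk k) S.Ω := by
  have hn' : (0 : ℝ) < n := by
    have : (3 : ℝ) ≤ n := by exact_mod_cast hn
    linarith
  have hq := S.hqk k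
  refine S.integrableOn_G_mul hn hx (W := S.lam k ^ ((n : ℝ) / (S.qk k + 1) * S.qk k))
    ((S.hu_cont k).rpow_const fun y hy => Or.inl (S.hu_pos k y hy).ne') fun y hy => ?_
  have hu := S.hu_pos k y hy
  rw [abs_of_pos (Real.rpow_pos_of_pos hu _)]
  have h1 := (le_max_right _ _).trans (S.hlam_sup k y hy)
  have h2 := Real.rpow_le_rpow (by positivity) h1
    (show 0 ≤ (n : ℝ) / (S.qk k + 1) * S.qk k by positivity)
  refine le_trans (le_of_eq ?_) h2
  rw [← Real.rpow_mul hu.le]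
  congr 1
  field_simp

/-- The mass of `v_k ^ p` in the ball `B(x_k, d_k)` grows at least logarithmically. -/
lemma exists_le_integral_ball_v_rpow {n : ℕ} (hn : 3 ≤ n) (S : BlowupSetup n)
    (hp : S.p = (n : ℝ) / ((n : ℝ) - 2)) {C₀ : ℝ} (hC₀ : 0 < C₀)
    (hHbd : ∀ x ∈ S.Ω, ∀ y ∈ S.Ω, x ≠ y →
      S.H x y ≤ C₀ * Metric.infDist y (frontier S.Ω) ^ ((2 : ℝ) - n))
    (hint : ∀ k, IntegrableOn (fun y => S.v k y ^ S.p) S.Ω)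
    (U : Euc n → ℝ) (hUc : Continuous U) (hUpos : ∀ x, 0 < U x)
    (hUlim : TendstoUniformlyOn
      (fun k x => S.lam k ^ (-((n : ℝ) / (S.qk k + 1))) * S.u k ((S.lam k)⁻¹ • x + S.xk k))
      U Filter.atTop (Metric.closedBall (0 : Euc n) 1)) :
    ∃ c, 0 < c ∧ ∀ᶠ k in atTop, c * Real.log (S.N k) ≤
      S.lam k ^ ((n : ℝ) / (S.p + 1)) * ∫ y in ball (S.xk k) (S.d k), S.v k y ^ S.p := by
  have hn0 : 0 < n := by omega
  have hn' : (3 : ℝ) ≤ n := by exact_mod_cast hn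
  have hc := S.cGreen_pos hn
  have hσ := polarConst_pos hn0
  obtain ⟨c, hc0, hcu⟩ := S.exists_le_u_rpow hn U hUc hUpos hUlim
  obtain ⟨δ, hδ, hδ1, hG⟩ := S.exists_le_G hn hC₀ hHbd
  obtain ⟨c', hc'⟩ : ∃ c', c' = cGreen n / 2 * 2 ^ ((2 : ℝ) - n) * c * (polarConst n / n) :=
    ⟨_, rfl⟩
  have hc'0 : 0 < c' := by rw [hc']; positivity
  refine ⟨c' ^ S.p * polarConst n / 2, by positivity, ?_⟩
  have hNlim : Tendsto S.N atTop atTop := S.hN_top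
  filter_upwards [hcu, hNlim.eventually_ge_atTop (1 / δ),
    hNlim.eventually_ge_atTop (δ ^ (-2 : ℝ))] with k hk hN1 hN2
  have hl := S.lam_pos k
  have hd := S.d_pos hn k
  set α := (n : ℝ) / (S.p + 1) with hα
  have hNδ : (S.lam k)⁻¹ ≤ δ * S.d k := by
    rw [inv_le_iff_one_le_mul₀ hl]
    rw [div_le_iff₀ hδ, N] at hN1
    linarith
  have hδd : δ * S.d k ≤ S.d k := by nlinarith
  have hbΩ : ball (S.xk k) (S.d k) ⊆ S.Ω :=
    (ball_subset_ball (by linarith)).trans (S.ball_subset k)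
  have hsub : ball (S.xk k) (S.lam k)⁻¹ ⊆ ball (S.xk k) (δ * S.d k) := ball_subset_ball hNδ
  have hsubΩ : ball (S.xk k) (δ * S.d k) ⊆ S.Ω := (ball_subset_ball hδd).trans hbΩ
  have hb0 := ball_rpow (n := n) (a := 0) hn0 (by positivity) (inv_pos.2 hl) (S.xk k)
  have hsh := shell_rpow hn0 (inv_pos.2 hl) hNδ (S.xk k)
  have hv : ∀ x ∈ ball (S.xk k) (δ * S.d k) \ ball (S.xk k) (S.lam k)⁻¹,
      c' * S.lam k ^ (2 + α - n) * ‖x - S.xk k‖ ^ ((2 : ℝ) - n) ≤ S.v k x := by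
    intro x hx
    have hxΩ := hsubΩ hx.1
    have hxn : (S.lam k)⁻¹ ≤ ‖x - S.xk k‖ := by
      have := hx.2
      rw [mem_ball_iff_norm] at this
      linarith
    have hx0 : 0 < ‖x - S.xk k‖ := (inv_pos.2 hl).trans_le hxn
    have hi := S.integrableOn_G_mul_u_rpow hn k hxΩ
    rw [S.hv_eq k x hxΩ]
    have hpoint : ∀ y ∈ ball (S.xk k) (S.lam k)⁻¹,
        (cGreen n / 2 * (2 * ‖x - S.xk k‖) ^ ((2 : ℝ) - n) * (c * S.lam k ^ (2 + α))) *
          ‖y - S.xk k‖ ^ (-(0 : ℝ)) ≤ S.G x y * S.u k y ^ S.qk k := by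
      intro y hy
      rw [neg_zero, Real.rpow_zero, mul_one]
      have hxy : x ≠ y := by
        rintro rfl
        exact hx.2 hy
      have hxy0 : 0 < ‖x - y‖ := norm_pos_iff.2 (sub_ne_zero.2 hxy)
      have hle : ‖x - y‖ ≤ 2 * ‖x - S.xk k‖ := by
        have h := norm_sub_le_norm_sub_add_norm_sub x (S.xk k) y
        rw [mem_ball_iff_norm'] at hy
        linarith
      have hGle : cGreen n / 2 * (2 * ‖x - S.xk k‖) ^ ((2 : ℝ) - n) ≤ S.G x y := by
        refine le_trans ?_ (hG k x hx.1 y (hsub hy) hxy)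
        exact mul_le_mul_of_nonneg_left
          (Real.rpow_le_rpow_of_nonpos hxy0 hle (by linarith)) (by positivity)
      exact mul_le_mul hGle (hk y hy) (by positivity) (S.Gpos x hxΩ y (hsubΩ (hsub hy)) hxy).le
    have hnn : ∀ᵐ y ∂(volume.restrict S.Ω), 0 ≤ S.G x y * S.u k y ^ S.qk k := by
      have : Nonempty (Fin n) := ⟨⟨0, hn0⟩⟩
      have hne : ∀ᵐ y ∂(volume.restrict S.Ω), y ≠ x := ae_restrict_of_ae (by simp [ae_iff])
      filter_upwards [ae_restrict_mem S.hΩo.measurableSet, hne] with y hy hyx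
      exact mul_nonneg (S.Gpos x hxΩ y hy hyx.symm).le (Real.rpow_nonneg (S.hu_pos k y hy).le _)
    refine le_trans ?_ (setIntegral_mono_set hi hnn (hsub.trans hsubΩ).eventuallyLE)
    refine le_trans (le_of_eq ?_) (setIntegral_mono_on (hb0.1.const_mul _)
      (hi.mono_set (hsub.trans hsubΩ)) measurableSet_ball hpoint)
    rw [integral_const_mul, hb0.2, sub_zero, Real.inv_rpow hl.le, ← Real.rpow_neg hl.le,
      Real.mul_rpow (by norm_num) hx0.le, hc', sub_eq_add_neg (2 + α) (n : ℝ), Real.rpow_add hl]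
    ring
  have hw : ∀ x ∈ ball (S.xk k) (δ * S.d k) \ ball (S.xk k) (S.lam k)⁻¹,
      c' ^ S.p * S.lam k ^ (-α) * ‖x - S.xk k‖ ^ (-(n : ℝ)) ≤ S.v k x ^ S.p := by
    intro x hx
    refine le_trans (le_of_eq ?_) (Real.rpow_le_rpow (by positivity) (hv x hx) S.p_pos.le)
    rw [Real.mul_rpow (by positivity) (by positivity), Real.mul_rpow hc'0.le (by positivity),
      ← Real.rpow_mul hl.le, ← Real.rpow_mul (norm_nonneg _), S.two_sub_mul_p hn hp,
      show (2 + α - n) * S.p = (2 - (n : ℝ)) * S.p + α * S.p by ring, S.two_sub_mul_p hn hp,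
      hα, S.div_mul_p]
    congr 3; ring
  have hlow : c' ^ S.p * S.lam k ^ (-α) * (polarConst n * Real.log (δ * S.d k / (S.lam k)⁻¹)) ≤
      ∫ y in ball (S.xk k) (S.d k), S.v k y ^ S.p := by
    have hi := (hint k).mono_set hbΩ
    have hss : ball (S.xk k) (δ * S.d k) \ ball (S.xk k) (S.lam k)⁻¹ ⊆ ball (S.xk k) (S.d k) :=
      Set.sdiff_subset.trans (ball_subset_ball hδd)
    have hnn : ∀ᵐ y ∂(volume.restrict (ball (S.xk k) (S.d k))), 0 ≤ S.v k y ^ S.p := by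
      filter_upwards [ae_restrict_mem measurableSet_ball] with y hy
      exact Real.rpow_nonneg (S.hv_pos k y (hbΩ hy)).le _
    refine le_trans ?_ (setIntegral_mono_set hi hnn hss.eventuallyLE)
    rw [← hsh.2, ← integral_const_mul]
    exact setIntegral_mono_on (hsh.1.const_mul _) (hi.mono_set hss)
      (measurableSet_ball.diff measurableSet_ball) hw
  have hNpos : 0 < S.N k := mul_pos hl hd
  have hlog : Real.log (S.N k) / 2 ≤ Real.log (δ * S.d k / (S.lam k)⁻¹) := by
    have h1 : δ * S.d k / (S.lam k)⁻¹ = δ * S.N k := by rw [N, div_inv_eq_mul]; ring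
    have h2 := Real.log_le_log (by positivity) hN2
    rw [Real.log_rpow hδ] at h2
    rw [h1, Real.log_mul hδ.ne' hNpos.ne']
    linarith
  calc c' ^ S.p * polarConst n / 2 * Real.log (S.N k)
      = c' ^ S.p * (polarConst n * (Real.log (S.N k) / 2)) := by ring
    _ ≤ c' ^ S.p * (polarConst n * Real.log (δ * S.d k / (S.lam k)⁻¹)) := by gcongr
    _ = S.lam k ^ α * (c' ^ S.p * S.lam k ^ (-α) *
          (polarConst n * Real.log (δ * S.d k / (S.lam k)⁻¹))) := by
        rw [Real.rpow_neg hl.le]; field_simp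
    _ ≤ _ := by gcongr

end BlowupSetup

/-- Sharp estimate of `u_k` and its gradient on the annulus `|x - x_k| = 2 d_k` in the
borderline case `p = n/(n-2)`, with a logarithmically divergent coefficient `K_k`. -/
theorem u_estimate_on_annulus_borderline
    (n : ℕ) (hn : 3 ≤ n) (S : BlowupSetup n)
    (hp : S.p = (n : ℝ) / ((n : ℝ) - 2))
    (hd0 : Filter.Tendsto S.d Filter.atTop (nhds 0))
    (C₀ : ℝ) (hC₀ : 0 < C₀)
    (hvbd : ∀ k, ∀ y ∈ S.Ω,
      S.v k y ≤ C₀ * S.lam k ^ ((n : ℝ) / (S.p + 1))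
        * (1 + S.lam k * ‖y - S.xk k‖) ^ ((2 : ℝ) - n))
    (hHbd : ∀ x ∈ S.Ω, ∀ y ∈ S.Ω, x ≠ y →
      S.H x y ≤ C₀ * Metric.infDist y (frontier S.Ω) ^ ((2 : ℝ) - n))
    (U : Euc n → ℝ) (hUc : Continuous U) (hUpos : ∀ x, 0 < U x)
    (hUlim : TendstoUniformlyOn
      (fun k x => S.lam k ^ (-((n : ℝ) / (S.qk k + 1))) * S.u k ((S.lam k)⁻¹ • x + S.xk k))
      U Filter.atTop (Metric.closedBall (0 : Euc n) 1)) :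
    ∃ c₁ c₂ C : ℝ, 0 < c₁ ∧ c₁ < c₂ ∧ 0 < C ∧
    ∃ K : ℕ → ℝ, (∀ k, 0 < K k) ∧
      (∀ᶠ k in Filter.atTop, c₁ * Real.log (S.N k) ≤ K k ∧ K k ≤ c₂ * Real.log (S.N k)) ∧
      (∀ᶠ k in Filter.atTop, ∀ x : Euc n, ‖x - S.xk k‖ = 2 * S.d k →
        |S.u k x - K k * S.lam k ^ (-((n : ℝ) / (S.p + 1))) * S.G x (S.xk k)|
            ≤ C * S.lam k ^ (-((n : ℝ) / (S.p + 1))) * S.d k ^ (-((n : ℝ) - 2)) ∧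
        ‖gradient (S.u k) x
            - (K k * S.lam k ^ (-((n : ℝ) / (S.p + 1)))) •
                gradient (fun z => S.G z (S.xk k)) x‖
            ≤ C * S.lam k ^ (-((n : ℝ) / (S.p + 1))) * S.d k ^ (-((n : ℝ) - 1))) := by
  have hn' : (3 : ℝ) ≤ n := by exact_mod_cast hn
  have hσ := polarConst_pos (n := n) (by omega)
  have hint := fun k => S.integrableOn_v_rpow hn hp hC₀ (hvbd k)
  obtain ⟨c, hc, hcK⟩ := S.exists_le_integral_ball_v_rpow hn hp hC₀ hHbd hint U hUc hUpos hUlim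
  obtain ⟨C, hC, hCb⟩ := S.exists_u_sub_mul_G_bound hn hp hC₀ hvbd
  refine ⟨c, c + C₀ ^ S.p * (polarConst n / n + polarConst n), C, hc,
    lt_add_of_pos_right _ (by positivity), hC,
    fun k => S.lam k ^ ((n : ℝ) / (S.p + 1)) *
      ∫ y in ball (S.xk k) (S.d k), S.v k y ^ S.p, fun k => ?_, ?_, ?_⟩
  · exact mul_pos (Real.rpow_pos_of_pos (S.lam_pos k) _)
      (S.integral_ball_v_rpow_pos hn k (hint k))
  · have hNlim : Tendsto S.N atTop atTop := S.hN_top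
    filter_upwards [hcK, hNlim.eventually_ge_atTop (Real.exp 1)] with k hk hNk
    have hl := S.lam_pos k
    have hlog : 1 ≤ Real.log (S.N k) := by
      rw [← Real.log_exp 1]
      exact Real.log_le_log (Real.exp_pos 1) hNk
    have hN1 : 1 ≤ S.N k := le_trans (by linarith [Real.add_one_le_exp 1]) hNk
    refine ⟨hk, ?_⟩
    calc S.lam k ^ ((n : ℝ) / (S.p + 1)) * ∫ y in ball (S.xk k) (S.d k), S.v k y ^ S.p
        ≤ S.lam k ^ ((n : ℝ) / (S.p + 1)) *
          (C₀ ^ S.p * S.lam k ^ (-((n : ℝ) / (S.p + 1))) *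
            (polarConst n / n + polarConst n * Real.log (S.N k))) := by
          gcongr
          exact S.integral_ball_v_rpow_le hn hp hC₀ (hvbd k) hN1
      _ = C₀ ^ S.p * (polarConst n / n * 1 + polarConst n * Real.log (S.N k)) := by
          rw [Real.rpow_neg hl.le]; field_simp
      _ ≤ C₀ ^ S.p * (polarConst n / n * Real.log (S.N k) +
            polarConst n * Real.log (S.N k)) := by gcongr
      _ = C₀ ^ S.p * (polarConst n / n + polarConst n) * Real.log (S.N k) := by ring
      _ ≤ _ := by
          gcongr
          linarith
  · refine Eventually.of_forall fun k x hx => ?_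
    have hl := S.lam_pos k
    have hK : S.lam k ^ ((n : ℝ) / (S.p + 1)) *
        (∫ y in ball (S.xk k) (S.d k), S.v k y ^ S.p) * S.lam k ^ (-((n : ℝ) / (S.p + 1))) =
        ∫ y in ball (S.xk k) (S.d k), S.v k y ^ S.p := by
      rw [Real.rpow_neg hl.le]; field_simp
    simp only [hK]
    exact hCb k x hx
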